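/- Let C ⊂ ℝ³ be a convex body and r₀ ∈ ∂C a ridge point whose tangent cone is the dihedral angle {r : (r − r₀, e₁) ≤ 0, (r − r₀, e₂) ≤ 0}, and let e = λ₁e₁ + λ₂e₂ with λ₁ > 0, λ₂ > 0, |e| = 1. If the set B₀ = C ∩ {r : (r − r₀, e) = 0} is a non-degenerate line segment, then the normalized surface measures ν_t weakly converge, as t → 0⁺, to the measure λ₁ δ_{e₁} + λ₂ δ_{e₂} on S². -/

import Mathlib

open MeasureTheory Set Filter Topology
open scoped RealInnerProductSpace ENNReal

noncomputable section

attribute [local instance] Classical.propDecidable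

abbrev E3 := EuclideanSpace ℝ (Fin 3)

/-- A convex body: a compact convex set with nonempty interior. -/
def IsConvexBody (C : Set E3) : Prop :=
  IsCompact C ∧ Convex ℝ C ∧ (interior C).Nonempty

/-- The tangent cone to a convex set `C` at the point `r₀`: the closure of the set of
rays from `r₀` through points of `C`, translated to the origin. -/
def tanCone (C : Set E3) (r₀ : E3) : Set E3 :=
  closure {v : E3 | ∃ c : ℝ, ∃ r ∈ C, 0 ≤ c ∧ v = c • (r - r₀)}

/-- The dihedral angle `{v : ⟪v,e₁⟫ ≤ 0, ⟪v,e₂⟫ ≤ 0}` (as a cone of displacements). -/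
def dihedral (e₁ e₂ : E3) : Set E3 := {v : E3 | ⟪v, e₁⟫ ≤ 0 ∧ ⟪v, e₂⟫ ≤ 0}

/-- `n` is an outward unit normal of `C` at `r`. -/
def IsOutwardNormalAt (C : Set E3) (r n : E3) : Prop :=
  ‖n‖ = 1 ∧ ∀ x ∈ C, ⟪x - r, n⟫ ≤ 0

/-- `r` is a regular boundary point: the outward unit normal exists and is unique. -/
def IsRegularPt (C : Set E3) (r : E3) : Prop :=
  ∃! n : E3, IsOutwardNormalAt C r n

/-- The (Gauss) normal map of `C`, sending a boundary point to an outward unit normal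
(the unique one at regular points), and junk value `0` elsewhere. -/
def normalMap (C : Set E3) (r : E3) : E3 :=
  if h : ∃ n : E3, IsOutwardNormalAt C r n then h.choose else 0

/-- `B_t = C ∩ {r : ⟪r - r₀, e⟫ = -t}`. -/
def Bset (C : Set E3) (r₀ e : E3) (t : ℝ) : Set E3 :=
  C ∩ {r : E3 | ⟪r - r₀, e⟫ = -t}

/-- `S_t = ∂C ∩ {r : ⟪r - r₀, e⟫ ≥ -t}`. -/
def Sset (C : Set E3) (r₀ e : E3) (t : ℝ) : Set E3 :=
  frontier C ∩ {r : E3 | ⟪r - r₀, e⟫ ≥ -t}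

/-- The normalized surface measure `ν_t` induced by `S_t`: the pushforward under the
normal map of the 2-dimensional Hausdorff measure restricted to the regular points of
`S_t`, normalized by the area of `B_t`. -/
def nuT (C : Set E3) (r₀ e : E3) (t : ℝ) : Measure E3 :=
  (μH[2] (Bset C r₀ e t))⁻¹ •
    Measure.map (normalMap C) (μH[2].restrict (Sset C r₀ e t ∩ {r : E3 | IsRegularPt C r}))

/-- The arc `Γ = {μ₁e₁ + μ₂e₂ : |μ₁e₁ + μ₂e₂| = 1, μ₁ ≥ 0, μ₂ ≥ 0}`. -/
def arcGamma (e₁ e₂ : E3) : Set E3 :=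
  {v : E3 | ∃ m₁ m₂ : ℝ, 0 ≤ m₁ ∧ 0 ≤ m₂ ∧ v = m₁ • e₁ + m₂ • e₂ ∧ ‖v‖ = 1}

/-- Weak convergence of the family `ν t` to `ν₀` as `t → 0⁺`. -/
def WeaklyTendsto (ν : ℝ → Measure E3) (ν₀ : Measure E3) : Prop :=
  ∀ f : BoundedContinuousFunction E3 ℝ,
    Tendsto (fun t => ∫ x, f x ∂(ν t)) (𝓝[>] (0 : ℝ)) (𝓝 (∫ x, f x ∂ν₀))

/-- `ν₀` is a partial weak limit of the family `ν t` as `t → 0⁺`. -/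
def IsPartialWeakLimit (ν : ℝ → Measure E3) (ν₀ : Measure E3) : Prop :=
  ∃ ts : ℕ → ℝ, (∀ i, 0 < ts i) ∧ Tendsto ts atTop (𝓝 (0 : ℝ)) ∧
    ∀ f : BoundedContinuousFunction E3 ℝ,
      Tendsto (fun i => ∫ x, f x ∂(ν (ts i))) atTop (𝓝 (∫ x, f x ∂ν₀))

/-- The support of a measure: points all of whose open neighborhoods have positive measure. -/
def msupport (ν : Measure E3) : Set E3 :=
  {x : E3 | ∀ U : Set E3, IsOpen U → x ∈ U → 0 < ν U}

abbrev E2 := EuclideanSpace ℝ (Fin 2)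

lemma hausdorff_le_of_anti {X Y : Type*} [MetricSpace X] [MeasurableSpace X] [BorelSpace X]
    [MetricSpace Y] [MeasurableSpace Y] [BorelSpace Y] (g : X → Y) (S : Set X) (K : ℝ) (hK : 0 ≤ K)
    (h : ∀ s ∈ S, ∀ s' ∈ S, dist s s' ≤ K * dist (g s) (g s')) :
    μH[2] S ≤ ENNReal.ofReal (K ^ 2) * μH[2] (g '' S) := by
  rcases S.eq_empty_or_nonempty with rfl | ⟨x0, hx0⟩
  · simp
  have : Nonempty X := ⟨x0⟩
  have hinj : InjOn g S := by
    intro x hx y hy hxy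
    have := h x hx y hy
    rw [hxy, dist_self, mul_zero] at this
    exact dist_le_zero.1 this
  have hleft : ∀ x ∈ S, Function.invFunOn g S (g x) = x := fun x hx =>
    hinj.leftInvOn_invFunOn hx
  have hlip : LipschitzOnWith (Real.toNNReal K) (Function.invFunOn g S) (g '' S) := by
    refine LipschitzOnWith.of_dist_le_mul ?_
    rintro _ ⟨x, hx, rfl⟩ _ ⟨y, hy, rfl⟩
    rw [hleft x hx, hleft y hy, Real.coe_toNNReal K hK]
    exact h x hx y hy
  have h1 := hlip.hausdorffMeasure_image_le (d := 2) (by norm_num)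
  have h2 : Function.invFunOn g S '' (g '' S) = S := by
    rw [image_image]
    ext z; constructor
    · rintro ⟨x, hx, rfl⟩
      simpa only [hleft x hx] using hx
    · intro hz; exact ⟨z, hz, hleft z hz⟩
  rw [h2] at h1
  refine h1.trans (le_of_eq ?_)
  congr 1
  rw [ENNReal.ofReal_pow hK]
  simp [ENNReal.ofReal]

/-- Hausdorff measure of rectangles -/
lemma exists_kappa : ∃ κ : ℝ, 0 < κ ∧ ∀ p q u v : ℝ, p ≤ q → u ≤ v →
    μH[2] {y : E2 | y 0 ∈ Icc p q ∧ y 1 ∈ Icc u v} = ENNReal.ofReal (κ * ((q - p) * (v - u))) := by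
  have hfr : ((Module.finrank ℝ E2 : ℕ) : ℝ) = 2 := by simp
  have : (μH[2] : Measure E2).IsAddHaarMeasure := by
    have := isAddHaarMeasure_hausdorffMeasure (E := E2)
    rwa [hfr] at this
  have heq := MeasureTheory.Measure.isAddLeftInvariant_eq_smul (μH[2] : Measure E2) volume
  have hvol : ∀ p q u v : ℝ, p ≤ q → u ≤ v →
      volume {y : E2 | y 0 ∈ Icc p q ∧ y 1 ∈ Icc u v} = ENNReal.ofReal ((q - p) * (v - u)) := by
    intro p q u v hpq huv
    have h1 : {y : E2 | y 0 ∈ Icc p q ∧ y 1 ∈ Icc u v} =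
        (fun y : E2 => (WithLp.ofLp y : Fin 2 → ℝ)) ⁻¹' (Set.pi univ ![Icc p q, Icc u v]) := by
      ext y; simp [Set.mem_pi, Fin.forall_fin_two]
    rw [h1, (PiLp.volume_preserving_ofLp (Fin 2)).measure_preimage]
    · rw [volume_pi, Measure.pi_pi]
      simp [Fin.prod_univ_two]
      rw [ENNReal.ofReal_mul (by linarith)]
    · exact (MeasurableSet.univ_pi (by
        intro i; fin_cases i <;> simp)).nullMeasurableSet
  obtain ⟨c, hc⟩ : ∃ c : NNReal, (μH[2] : Measure E2) = c • volume := ⟨_, heq⟩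
  have hcpos : 0 < c := by
    rcases eq_or_ne c 0 with h0 | h0
    · exfalso
      rw [h0, zero_smul] at hc
      have := (inferInstance : (μH[2] : Measure E2).IsAddHaarMeasure).open_pos univ isOpen_univ ⟨0, trivial⟩
      rw [hc] at this
      simp at this
    · exact pos_iff_ne_zero.2 h0
  refine ⟨c, by exact_mod_cast hcpos, ?_⟩
  intro p q u v hpq huv
  rw [hc, Measure.smul_apply, hvol p q u v hpq huv, ENNReal.ofReal_mul (by positivity)]
  simp [ENNReal.smul_def, ENNReal.ofReal_mul (sub_nonneg.2 hpq)]

def kap : ℝ := exists_kappa.choose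
lemma kap_pos : 0 < kap := exists_kappa.choose_spec.1
lemma kap_rect : ∀ p q u v : ℝ, p ≤ q → u ≤ v →
    μH[2] {y : E2 | y 0 ∈ Icc p q ∧ y 1 ∈ Icc u v} = ENNReal.ofReal (kap * ((q - p) * (v - u))) :=
  exists_kappa.choose_spec.2

instance : (μH[2] : Measure E2).IsAddHaarMeasure := by
  have hfr : ((Module.finrank ℝ E2 : ℕ) : ℝ) = 2 := by simp
  have := isAddHaarMeasure_hausdorffMeasure (E := E2)
  rwa [hfr] at this

/-- orthonormal triples, via Parseval -/
def ONT (m j k : E3) : Prop := ∀ v : E3, ‖v‖ ^ 2 = ⟪v, m⟫ ^ 2 + ⟪v, j⟫ ^ 2 + ⟪v, k⟫ ^ 2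

lemma ONT.rot {m j k : E3} (h : ONT m j k) : ONT j k m := fun v => by rw [h v]; ring
lemma ONT.swap {m j k : E3} (h : ONT m j k) : ONT j m k := fun v => by rw [h v]; ring
lemma ONT.neg {m j k : E3} (h : ONT m j k) : ONT (-m) j k := fun v => by
  rw [h v, inner_neg_right]; ring

lemma ONT.inner {m j k : E3} (h : ONT m j k) (v w : E3) :
    ⟪v, w⟫ = ⟪v, m⟫ * ⟪w, m⟫ + ⟪v, j⟫ * ⟪w, j⟫ + ⟪v, k⟫ * ⟪w, k⟫ := by
  have h1 := h (v + w)
  have h2 := norm_add_sq_real v w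
  have h3 := h v
  have h4 := h w
  simp only [inner_add_left] at h1
  nlinarith

/-- projection to the plane with coordinates j k -/
def Qp (r₀ j k : E3) (r : E3) : E2 := !₂[⟪r - r₀, j⟫, ⟪r - r₀, k⟫]

@[simp] lemma Qp_zero (r₀ j k r : E3) : Qp r₀ j k r 0 = ⟪r - r₀, j⟫ := by simp [Qp]
@[simp] lemma Qp_one (r₀ j k r : E3) : Qp r₀ j k r 1 = ⟪r - r₀, k⟫ := by simp [Qp]

lemma Qp_dist (r₀ j k r r' : E3) :
    dist (Qp r₀ j k r) (Qp r₀ j k r') ^ 2 = ⟪r - r', j⟫ ^ 2 + ⟪r - r', k⟫ ^ 2 := by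
  have e : r - r' = (r - r₀) - (r' - r₀) := by abel
  rw [EuclideanSpace.dist_eq, Real.sq_sqrt (by positivity), Fin.sum_univ_two]
  simp only [Qp_zero, Qp_one, Real.dist_eq, sq_abs]
  rw [e, inner_sub_left (r - r₀), inner_sub_left (r - r₀)]

lemma Qp_lip {m j k : E3} (h : ONT m j k) (r₀ : E3) : LipschitzWith 1 (Qp r₀ j k) := by
  refine LipschitzWith.of_dist_le_mul fun r r' => ?_
  rw [NNReal.coe_one, one_mul]
  refine abs_le_of_sq_le_sq' ?_ dist_nonneg |>.2
  rw [Qp_dist, dist_eq_norm, h (r - r')]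
  nlinarith [sq_nonneg ⟪r - r', m⟫]

lemma Qp_measure_le {m j k : E3} (h : ONT m j k) (r₀ : E3) (S : Set E3) :
    μH[2] (Qp r₀ j k '' S) ≤ μH[2] S := by
  simpa using (Qp_lip h r₀).hausdorffMeasure_image_le (d := 2) (by norm_num) S

lemma graph_upper {m j k : E3} (h : ONT m j k) (r₀ : E3) (S : Set E3) (σ : ℝ) (hσ : 0 ≤ σ)
    (hS : ∀ s ∈ S, ∀ s' ∈ S, |⟪s - s', m⟫| ≤ σ * dist (Qp r₀ j k s) (Qp r₀ j k s')) :
    μH[2] S ≤ ENNReal.ofReal ((1 + σ) ^ 2) * μH[2] (Qp r₀ j k '' S) := by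
  refine hausdorff_le_of_anti _ S (1 + σ) (by linarith) fun s hs s' hs' => ?_
  refine abs_le_of_sq_le_sq' ?_ (by positivity) |>.2
  rw [dist_eq_norm s s', h (s - s')]
  have h1 := hS s hs s' hs'
  have h2 := Qp_dist r₀ j k s s'
  have h3 : ⟪s - s', m⟫ ^ 2 ≤ (σ * dist (Qp r₀ j k s) (Qp r₀ j k s')) ^ 2 := by
    rw [← sq_abs]; gcongr
  have h4 : 0 ≤ σ * dist (Qp r₀ j k s) (Qp r₀ j k s') ^ 2 := by positivity
  nlinarith

/-- normal slope condition -/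
def SlopeN (C : Set E3) (m j k : E3) (σ : ℝ) (s : E3) : Prop :=
  s ∈ C ∧ ∃ n, IsOutwardNormalAt C s n ∧ 0 < ⟪n, m⟫ ∧
    ⟪n, j⟫ ^ 2 + ⟪n, k⟫ ^ 2 ≤ (σ * ⟪n, m⟫) ^ 2

lemma slope_aux {m j k d n : E3} (h : ONT m j k) {σ D : ℝ} (hσ : 0 ≤ σ) (hD : 0 ≤ D)
    (hd : D ^ 2 = ⟪d, j⟫ ^ 2 + ⟪d, k⟫ ^ 2) (hn : 0 < ⟪n, m⟫)
    (hs : ⟪n, j⟫ ^ 2 + ⟪n, k⟫ ^ 2 ≤ (σ * ⟪n, m⟫) ^ 2) (hle : ⟪d, n⟫ ≤ 0) :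
    ⟪d, m⟫ ≤ σ * D := by
  rw [h.inner d n] at hle
  have h1 : -(⟪d, j⟫ * ⟪n, j⟫ + ⟪d, k⟫ * ⟪n, k⟫) ≤ D * (σ * ⟪n, m⟫) := by
    refine abs_le_of_sq_le_sq' ?_ (by positivity) |>.2
    have : (D * (σ * ⟪n, m⟫)) ^ 2 = D ^ 2 * (σ * ⟪n, m⟫) ^ 2 := by ring
    rw [this, hd]
    have h2 : (⟪d, j⟫ ^ 2 + ⟪d, k⟫ ^ 2) * (⟪n, j⟫ ^ 2 + ⟪n, k⟫ ^ 2) ≤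
        (⟪d, j⟫ ^ 2 + ⟪d, k⟫ ^ 2) * (σ * ⟪n, m⟫) ^ 2 := by gcongr
    nlinarith [sq_nonneg (⟪d, j⟫ * ⟪n, k⟫ - ⟪d, k⟫ * ⟪n, j⟫)]
  have h3 : ⟪d, m⟫ * ⟪n, m⟫ ≤ (σ * D) * ⟪n, m⟫ := by linarith
  exact le_of_mul_le_mul_right h3 hn

lemma slope_upper {C : Set E3} {m j k : E3} (h : ONT m j k) (r₀ : E3) (S : Set E3) (σ : ℝ)
    (hσ : 0 ≤ σ) (hS : ∀ s ∈ S, SlopeN C m j k σ s) :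
    μH[2] S ≤ ENNReal.ofReal ((1 + σ) ^ 2) * μH[2] (Qp r₀ j k '' S) := by
  refine graph_upper h r₀ S σ hσ fun s hs s' hs' => ?_
  have hd := Qp_dist r₀ j k s s'
  have hd' := Qp_dist r₀ j k s' s
  rw [dist_comm] at hd'
  obtain ⟨hsC, n, hn, hn1, hn2⟩ := hS s hs
  obtain ⟨hsC', n', hn', hn1', hn2'⟩ := hS s' hs'
  rw [abs_le]
  constructor
  · have := slope_aux h hσ dist_nonneg hd' hn1 hn2 (hn.2 s' hsC')
    have e : ⟪s - s', m⟫ = - ⟪s' - s, m⟫ := by rw [← inner_neg_left]; simp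
    linarith
  · exact slope_aux h hσ dist_nonneg hd hn1' hn2' (hn'.2 s hsC)

/-- upper bound for piece over a rectangle -/
lemma slope_rect {C : Set E3} {m j k : E3} (h : ONT m j k) (r₀ : E3) (S : Set E3) (σ : ℝ)
    (hσ : 0 ≤ σ) (hS : ∀ s ∈ S, SlopeN C m j k σ s) {p q u v : ℝ} (hpq : p ≤ q) (huv : u ≤ v)
    (hj : ∀ s ∈ S, ⟪s - r₀, j⟫ ∈ Icc p q) (hk : ∀ s ∈ S, ⟪s - r₀, k⟫ ∈ Icc u v) :
    μH[2] S ≤ ENNReal.ofReal ((1 + σ) ^ 2 * (kap * ((q - p) * (v - u)))) := by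
  refine (slope_upper h r₀ S σ hσ hS).trans ?_
  rw [ENNReal.ofReal_mul (by positivity), ← kap_rect p q u v hpq huv]
  gcongr
  rintro _ ⟨s, hs, rfl⟩
  simp only [mem_ofPred_eq, Qp_zero, Qp_one]
  exact ⟨hj s hs, hk s hs⟩

lemma exists_normal {C : Set E3} (hC : IsConvexBody C) {s : E3} (hs : s ∈ frontier C) :
    ∃ n, IsOutwardNormalAt C s n := by
  obtain ⟨hcpt, hconv, hint⟩ := hC
  have hns : s ∉ interior C := by
    rw [frontier] at hs; exact hs.2
  obtain ⟨f, hf⟩ := geometric_hahn_banach_open_point hconv.interior isOpen_interior hns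
  set w := (InnerProductSpace.toDual ℝ E3).symm f with hw
  have hfw : ∀ x, f x = ⟪x, w⟫ := fun x => by
    rw [real_inner_comm, hw, InnerProductSpace.toDual_symm_apply]
  have hle : ∀ x ∈ C, f x ≤ f s := by
    intro x hx
    have hx' : x ∈ closure (interior C) := by
      rw [hconv.closure_interior_eq_closure_of_nonempty_interior hint]
      exact subset_closure hx
    exact closure_minimal (fun a ha => (hf a ha).le)
      (isClosed_le f.continuous continuous_const) hx'
  have hw0 : w ≠ 0 := by
    intro h0
    obtain ⟨a, ha⟩ := hint
    have := hf a ha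
    rw [hfw, hfw, h0] at this
    simp at this
  have hwp : 0 < ‖w‖ := norm_pos_iff.2 hw0
  refine ⟨‖w‖⁻¹ • w, by rw [norm_smul, norm_inv, norm_norm, inv_mul_cancel₀ hwp.ne'], ?_⟩
  intro x hx
  rw [inner_smul_right, inner_sub_left, ← hfw, ← hfw]
  have := hle x hx
  exact mul_nonpos_of_nonneg_of_nonpos (by positivity) (by linarith)

lemma crude_one {C : Set E3} {m j k : E3} (h : ONT m j k) (r₀ : E3) (S : Set E3)
    (hS : ∀ s ∈ S, s ∈ C ∧ ∃ n, IsOutwardNormalAt C s n ∧ 1 / 2 ≤ ⟪n, m⟫)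
    {p q u v : ℝ} (hpq : p ≤ q) (huv : u ≤ v)
    (hj : ∀ s ∈ S, ⟪s - r₀, j⟫ ∈ Icc p q) (hk : ∀ s ∈ S, ⟪s - r₀, k⟫ ∈ Icc u v) :
    μH[2] S ≤ ENNReal.ofReal (9 * (kap * ((q - p) * (v - u)))) := by
  have := slope_rect (C := C) h r₀ S 2 (by norm_num) (fun s hs => ?_) hpq huv hj hk
  · norm_num at this ⊢
    exact this
  · obtain ⟨hsC, n, hn, hn'⟩ := hS s hs
    refine ⟨hsC, n, hn, by linarith, ?_⟩
    have := h n
    rw [hn.1] at this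
    nlinarith

/-- crude bound in a box -/
lemma crude_box {C : Set E3} (hC : IsConvexBody C) {m j k : E3} (h : ONT m j k) (r₀ : E3)
    (S : Set E3) (hS : S ⊆ frontier C) {p q u v z w : ℝ} (hpq : p ≤ q) (huv : u ≤ v) (hzw : z ≤ w)
    (hm : ∀ s ∈ S, ⟪s - r₀, m⟫ ∈ Icc z w)
    (hj : ∀ s ∈ S, ⟪s - r₀, j⟫ ∈ Icc p q) (hk : ∀ s ∈ S, ⟪s - r₀, k⟫ ∈ Icc u v) :
    μH[2] S ≤ ENNReal.ofReal (18 * kap *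
      ((q - p) * (v - u) + (v - u) * (w - z) + (w - z) * (q - p))) := by
  have hSC : ∀ s ∈ S, s ∈ C := fun s hs => hC.1.isClosed.frontier_subset (hS hs)
  let T : E3 → Set E3 := fun m' => {s ∈ S | ∃ n, IsOutwardNormalAt C s n ∧ 1 / 2 ≤ ⟪n, m'⟫}
  have hT : ∀ m', ∀ s ∈ T m', s ∈ C ∧ ∃ n, IsOutwardNormalAt C s n ∧ 1 / 2 ≤ ⟪n, m'⟫ :=
    fun m' s hs => ⟨hSC s hs.1, hs.2⟩
  have hcov : S ⊆ (T m ∪ T (-m)) ∪ (T j ∪ T (-j)) ∪ (T k ∪ T (-k)) := by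
    intro s hs
    obtain ⟨n, hn⟩ := exists_normal hC (hS hs)
    by_contra hcon
    simp only [mem_union, not_or] at hcon
    obtain ⟨⟨⟨h1, h2⟩, h3, h4⟩, h5, h6⟩ := hcon
    have key : ∀ m', s ∉ T m' → ⟪n, m'⟫ < 1 / 2 := by
      intro m' hm'
      by_contra hlt
      exact hm' ⟨hs, n, hn, not_lt.1 hlt⟩
    replace h1 := key _ h1
    replace h2 := key _ h2
    replace h3 := key _ h3
    replace h4 := key _ h4
    replace h5 := key _ h5
    replace h6 := key _ h6
    rw [inner_neg_right] at h2 h4 h6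
    have := h n
    rw [hn.1] at this
    nlinarith
  have k0 := kap_pos
  have b1 := crude_one h r₀ (T m) (hT m) hpq huv (fun s hs => hj s hs.1) (fun s hs => hk s hs.1)
  have b2 := crude_one h.neg r₀ (T (-m)) (hT (-m)) hpq huv (fun s hs => hj s hs.1)
    (fun s hs => hk s hs.1)
  have b3 := crude_one h.rot r₀ (T j) (hT j) huv hzw (fun s hs => hk s hs.1)
    (fun s hs => hm s hs.1)
  have b4 := crude_one h.rot.neg r₀ (T (-j)) (hT (-j)) huv hzw (fun s hs => hk s hs.1)
    (fun s hs => hm s hs.1)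
  have b5 := crude_one h.rot.rot r₀ (T k) (hT k) hzw hpq (fun s hs => hm s hs.1)
    (fun s hs => hj s hs.1)
  have b6 := crude_one h.rot.rot.neg r₀ (T (-k)) (hT (-k)) hzw hpq (fun s hs => hm s hs.1)
    (fun s hs => hj s hs.1)
  have n1 : 0 ≤ 9 * (kap * ((q - p) * (v - u))) := by
    have := sub_nonneg.2 hpq; have := sub_nonneg.2 huv; positivity
  have n2 : 0 ≤ 9 * (kap * ((v - u) * (w - z))) := by
    have := sub_nonneg.2 hzw; have := sub_nonneg.2 huv; positivity
  have n3 : 0 ≤ 9 * (kap * ((w - z) * (q - p))) := by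
    have := sub_nonneg.2 hpq; have := sub_nonneg.2 hzw; positivity
  calc μH[2] S ≤ μH[2] ((T m ∪ T (-m)) ∪ (T j ∪ T (-j)) ∪ (T k ∪ T (-k))) := measure_mono hcov
    _ ≤ ((μH[2] (T m) + μH[2] (T (-m))) + (μH[2] (T j) + μH[2] (T (-j)))) +
        (μH[2] (T k) + μH[2] (T (-k))) := by
      refine (measure_union_le _ _).trans (add_le_add ?_ (measure_union_le _ _))
      exact (measure_union_le _ _).trans (add_le_add (measure_union_le _ _) (measure_union_le _ _))
    _ ≤ _ := by
      refine (add_le_add (add_le_add (add_le_add b1 b2) (add_le_add b3 b4))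
        (add_le_add b5 b6)).trans (le_of_eq ?_)
      rw [← ENNReal.ofReal_add n1 n1, ← ENNReal.ofReal_add n2 n2, ← ENNReal.ofReal_add n3 n3,
        ← ENNReal.ofReal_add (by linarith) (by linarith),
        ← ENNReal.ofReal_add (by linarith) (by linarith)]
      congr 1; ring
/-- gradient in plane coordinates determined by a normal -/
def gradN (m j k n : E3) : E2 := !₂[-(⟪n, j⟫ / ⟪n, m⟫), -(⟪n, k⟫ / ⟪n, m⟫)]

lemma inner_E2 (v w : E2) : ⟪v, w⟫ = v 0 * w 0 + v 1 * w 1 := by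
  simp [PiLp.inner_apply, Fin.sum_univ_two, mul_comm]

lemma gradN_norm {m j k n : E3} (h : ONT m j k) (hn : ‖n‖ = 1) (hm : 1 / 2 ≤ ⟪n, m⟫) :
    ‖gradN m j k n‖ ≤ 2 := by
  have hp : 0 < ⟪n, m⟫ := by linarith
  refine abs_le_of_sq_le_sq' ?_ (by norm_num) |>.2
  rw [← real_inner_self_eq_norm_sq, inner_E2]
  have h1 := h n
  rw [hn] at h1
  simp only [gradN]
  have : (-(⟪n, j⟫ / ⟪n, m⟫)) * (-(⟪n, j⟫ / ⟪n, m⟫)) + (-(⟪n, k⟫ / ⟪n, m⟫)) * (-(⟪n, k⟫ / ⟪n, m⟫))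
      = (⟪n, j⟫ ^ 2 + ⟪n, k⟫ ^ 2) / ⟪n, m⟫ ^ 2 := by field_simp
  simp only [PiLp.toLp_apply, Matrix.cons_val_zero, Matrix.cons_val_one]
  rw [this, div_le_iff₀ (by positivity)]
  nlinarith

lemma gradN_inj {m j k n n' : E3} (h : ONT m j k) (hn : ‖n‖ = 1) (hn' : ‖n'‖ = 1)
    (hm : 1 / 2 ≤ ⟪n, m⟫) (hm' : 1 / 2 ≤ ⟪n', m⟫) (hg : gradN m j k n = gradN m j k n') :
    n = n' := by
  have hp : 0 < ⟪n, m⟫ := by linarith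
  have hp' : 0 < ⟪n', m⟫ := by linarith
  have g0 := congrArg (fun y : E2 => y 0) hg
  have g1 := congrArg (fun y : E2 => y 1) hg
  simp only [gradN, PiLp.toLp_apply, Matrix.cons_val_zero, Matrix.cons_val_one, neg_inj] at g0 g1
  rw [div_eq_div_iff hp.ne' hp'.ne'] at g0 g1
  have hz : ⟪n', m⟫ • n - ⟪n, m⟫ • n' = 0 := by
    rw [← norm_eq_zero, ← sq_eq_zero_iff, h]
    simp only [inner_sub_left, inner_smul_left, RCLike.conj_to_real]
    have e1 : ⟪n', m⟫ * ⟪n, m⟫ - ⟪n, m⟫ * ⟪n', m⟫ = 0 := by ring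
    have e2 : ⟪n', m⟫ * ⟪n, j⟫ - ⟪n, m⟫ * ⟪n', j⟫ = 0 := by linarith
    have e3 : ⟪n', m⟫ * ⟪n, k⟫ - ⟪n, m⟫ * ⟪n', k⟫ = 0 := by linarith
    rw [e1, e2, e3]; norm_num
  have h2 : ⟪n', m⟫ • n = ⟪n, m⟫ • n' := sub_eq_zero.1 hz
  have h3 := congrArg norm h2
  rw [norm_smul, norm_smul, hn, hn', Real.norm_of_nonneg hp.le, Real.norm_of_nonneg hp'.le] at h3
  have h4 : ⟪n', m⟫ = ⟪n, m⟫ := by linarith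
  rw [h4] at h2
  exact smul_right_injective _ hp.ne' h2

lemma nonreg_null {C : Set E3} {m j k : E3} (h : ONT m j k) (r₀ : E3) (S : Set E3)
    (hS : ∀ s ∈ S, s ∈ C ∧ ∃ n n', n ≠ n' ∧ IsOutwardNormalAt C s n ∧ IsOutwardNormalAt C s n' ∧
      1 / 2 ≤ ⟪n, m⟫ ∧ 1 / 2 ≤ ⟪n', m⟫) :
    μH[2] (Qp r₀ j k '' S) = 0 := by
  rcases S.eq_empty_or_nonempty with rfl | ⟨x0, hx0⟩
  · simp
  let I := {p : E3 × E3 // p.1 ∈ C ∧ IsOutwardNormalAt C p.1 p.2 ∧ 1 / 2 ≤ ⟪p.2, m⟫}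
  have hI : Nonempty I := by
    obtain ⟨hC, n, n', hnn, hn, hn', hm, hm'⟩ := hS x0 hx0
    exact ⟨⟨(x0, n), hC, hn, hm⟩⟩
  let A : I → E2 → ℝ := fun p y =>
    ⟪p.1.1 - r₀, m⟫ + ⟪gradN m j k p.1.2, y - Qp r₀ j k p.1.1⟫
  have hA1 : ∀ p : I, ∀ x ∈ C, ⟪x - r₀, m⟫ ≤ A p (Qp r₀ j k x) := by
    rintro ⟨⟨s, n⟩, hs, hn, hm⟩ x hx
    have hp : 0 < ⟪n, m⟫ := by dsimp at hm; linarith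
    have h1 := hn.2 x hx
    dsimp only at h1
    rw [h.inner] at h1
    simp only [A]
    rw [inner_E2]
    simp only [gradN, PiLp.sub_apply, Qp_zero, Qp_one, PiLp.toLp_apply, Matrix.cons_val_zero,
      Matrix.cons_val_one]
    have e : ∀ w : E3, ⟪x - s, w⟫ = ⟪x - r₀, w⟫ - ⟪s - r₀, w⟫ := by
      intro w; rw [← inner_sub_left]; congr 1; abel
    rw [e, e, e] at h1
    have h2 : (⟪x - r₀, m⟫ - ⟪s - r₀, m⟫) ≤ (-((⟪x - r₀, j⟫ - ⟪s - r₀, j⟫) * ⟪n, j⟫ +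
        (⟪x - r₀, k⟫ - ⟪s - r₀, k⟫) * ⟪n, k⟫)) / ⟪n, m⟫ := by
      rw [le_div_iff₀ hp]; linarith
    have e3 : (-((⟪x - r₀, j⟫ - ⟪s - r₀, j⟫) * ⟪n, j⟫ +
        (⟪x - r₀, k⟫ - ⟪s - r₀, k⟫) * ⟪n, k⟫)) / ⟪n, m⟫ =
        -(⟪n, j⟫ / ⟪n, m⟫) * (⟪x - r₀, j⟫ - ⟪s - r₀, j⟫) +
        -(⟪n, k⟫ / ⟪n, m⟫) * (⟪x - r₀, k⟫ - ⟪s - r₀, k⟫) := by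
      field_simp; ring
    linarith
  have hA2 : ∀ p : I, ∀ y y', A p y ≤ A p y' + 2 * dist y y' := by
    intro p y y'
    have e : A p y = A p y' + ⟪gradN m j k p.1.2, y - y'⟫ := by
      simp only [A]
      rw [add_assoc, ← inner_add_right]; congr 2; abel
    rw [e]
    have h1 := real_inner_le_norm (gradN m j k p.1.2) (y - y')
    have h2 := gradN_norm h p.2.2.1.1 p.2.2.2
    rw [dist_eq_norm]
    have h3 := mul_le_mul_of_nonneg_right h2 (norm_nonneg (y - y'))
    linarith
  have hx0C : x0 ∈ C := (hS x0 hx0).1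
  have hbdd : ∀ y, BddBelow (range fun p : I => A p y) := by
    intro y
    refine ⟨⟪x0 - r₀, m⟫ - 2 * dist (Qp r₀ j k x0) y, ?_⟩
    rintro _ ⟨p, rfl⟩
    have h1 := hA1 p x0 hx0C
    have h2 := hA2 p (Qp r₀ j k x0) y
    dsimp only; linarith
  let u : E2 → ℝ := fun y => ⨅ p : I, A p y
  have hlip : LipschitzWith 2 u := by
    refine LipschitzWith.of_le_add_mul 2 fun y y' => ?_
    rw [← sub_le_iff_le_add]
    refine le_ciInf fun p => ?_
    have h1 : u y ≤ A p y := ciInf_le (hbdd y) p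
    have h2 := hA2 p y y'
    simp only [NNReal.coe_ofNat]
    linarith
  have hu : ∀ p : I, u (Qp r₀ j k p.1.1) = ⟪p.1.1 - r₀, m⟫ := by
    intro p
    apply le_antisymm
    · have : u (Qp r₀ j k p.1.1) ≤ A p (Qp r₀ j k p.1.1) := ciInf_le (hbdd _) p
      simpa [A] using this
    · exact le_ciInf fun p' => hA1 p' _ p.2.1
  have hder : ∀ p : I, DifferentiableAt ℝ u (Qp r₀ j k p.1.1) →
      fderiv ℝ u (Qp r₀ j k p.1.1) = innerSL ℝ (gradN m j k p.1.2) := by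
    intro p hd
    have h1 : HasFDerivAt (fun y => u y - innerSL ℝ (gradN m j k p.1.2) y)
        (fderiv ℝ u (Qp r₀ j k p.1.1) - innerSL ℝ (gradN m j k p.1.2)) (Qp r₀ j k p.1.1) :=
      hd.hasFDerivAt.sub (ContinuousLinearMap.hasFDerivAt _)
    have h2 : IsLocalMax (fun y => u y - innerSL ℝ (gradN m j k p.1.2) y) (Qp r₀ j k p.1.1) := by
      refine Filter.Eventually.of_forall fun y => ?_
      have h3 : u y ≤ A p y := ciInf_le (hbdd y) p
      have h4 := hu p
      simp only [A, inner_sub_right] at h3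
      simp only [innerSL_apply_apply]
      rw [h4]; linarith
    exact sub_eq_zero.1 (h2.hasFDerivAt_eq_zero h1)
  have hae := hlip.ae_differentiableAt (μ := (μH[2] : Measure E2))
  refine measure_mono_null ?_ hae
  rintro _ ⟨s, hs, rfl⟩ hd
  obtain ⟨hC, n, n', hnn, hn, hn', hm, hm'⟩ := hS s hs
  have d1 := hder ⟨(s, n), hC, hn, hm⟩ hd
  have d2 := hder ⟨(s, n'), hC, hn', hm'⟩ hd
  rw [d1] at d2
  have d3 : gradN m j k n = gradN m j k n' := by
    refine ext_inner_right ℝ fun v => ?_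
    simpa using congrArg (fun L : E2 →L[ℝ] ℝ => L v) d2
  exact hnn (gradN_inj h hn.1 hn'.1 hm hm' d3)

/-! measurability -/

lemma normalMap_spec {C : Set E3} {r : E3} (h : ∃ n, IsOutwardNormalAt C r n) :
    IsOutwardNormalAt C r (normalMap C r) := by
  rw [normalMap, dif_pos h]
  exact h.choose_spec

lemma isClosed_normal (C : Set E3) : IsClosed {p : E3 × E3 | IsOutwardNormalAt C p.1 p.2} := by
  have : {p : E3 × E3 | IsOutwardNormalAt C p.1 p.2} =
      {p | ‖p.2‖ = 1} ∩ ⋂ x ∈ C, {p | ⟪x - p.1, p.2⟫ ≤ 0} := by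
    ext p; simp [IsOutwardNormalAt]
  rw [this]
  refine IsClosed.inter (isClosed_eq (by fun_prop) continuous_const) ?_
  exact isClosed_biInter fun x _ => isClosed_le (by fun_prop) continuous_const

lemma isCompact_normal {C : Set E3} {D : Set E3} (hD : IsCompact D) :
    IsCompact {p : E3 × E3 | p.1 ∈ D ∧ IsOutwardNormalAt C p.1 p.2} := by
  have h1 : IsCompact (D ×ˢ Metric.sphere (0 : E3) 1) := hD.prod (isCompact_sphere 0 1)
  have : {p : E3 × E3 | p.1 ∈ D ∧ IsOutwardNormalAt C p.1 p.2} =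
      (D ×ˢ Metric.sphere (0 : E3) 1) ∩ {p : E3 × E3 | IsOutwardNormalAt C p.1 p.2} := by
    ext p
    simp only [mem_ofPred_eq, mem_inter_iff, mem_prod, mem_sphere_iff_norm, sub_zero]
    constructor
    · rintro ⟨a, b⟩; exact ⟨⟨a, b.1⟩, b⟩
    · rintro ⟨⟨a, _⟩, b⟩; exact ⟨a, b⟩
  rw [this]
  exact h1.inter_right (isClosed_normal C)

lemma measurable_reg {C : Set E3} (hC : IsConvexBody C) {D : Set E3} (hD : IsCompact D)
    (hDC : D ⊆ frontier C) : MeasurableSet (D ∩ {r | IsRegularPt C r}) := by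
  let N : ℕ → Set E3 := fun i => (fun q : (E3 × E3) × (E3 × E3) => q.1.1) ''
    (({p : E3 × E3 | p.1 ∈ D ∧ IsOutwardNormalAt C p.1 p.2} ×ˢ
      {p : E3 × E3 | p.1 ∈ D ∧ IsOutwardNormalAt C p.1 p.2}) ∩
      {q | q.1.1 = q.2.1 ∧ 1 / ((i : ℝ) + 1) ≤ ‖q.1.2 - q.2.2‖})
  have hN : ∀ i, MeasurableSet (N i) := by
    intro i
    refine IsCompact.measurableSet ?_
    refine IsCompact.image ?_ (by fun_prop)
    refine ((isCompact_normal hD).prod (isCompact_normal hD)).inter_right ?_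
    have c1 : IsClosed {q : (E3 × E3) × (E3 × E3) | q.1.1 = q.2.1} :=
      isClosed_eq (by fun_prop) (by fun_prop)
    have c2 : IsClosed {q : (E3 × E3) × (E3 × E3) | 1 / ((i : ℝ) + 1) ≤ ‖q.1.2 - q.2.2‖} :=
      isClosed_le continuous_const (by fun_prop)
    exact c1.inter c2
  have : D ∩ {r | IsRegularPt C r} = D \ ⋃ i, N i := by
    ext s
    simp only [mem_inter_iff, mem_ofPred_eq, Set.mem_sdiff, mem_iUnion, not_exists]
    refine and_congr_right fun hs => ?_
    constructor
    · rintro ⟨n, hn, hu⟩ i ⟨⟨⟨s1, n1⟩, ⟨s2, n2⟩⟩, ⟨⟨h1, h2⟩, h3, h4⟩, h5⟩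
      dsimp only at h1 h2 h3 h4 h5
      have h1' := h1.2; have h2' := h2.2
      dsimp only at h1' h2'
      subst h5
      rw [← h3] at h2'
      rw [hu _ h1', hu _ h2', sub_self, norm_zero] at h4
      have : (0 : ℝ) < 1 / ((i : ℝ) + 1) := by positivity
      linarith
    · intro hcon
      obtain ⟨n, hn⟩ := exists_normal hC (hDC hs)
      refine ⟨n, hn, fun n' hn' => ?_⟩
      by_contra hne
      have hpos : 0 < ‖n' - n‖ := norm_pos_iff.2 (sub_ne_zero.2 hne)
      obtain ⟨i, hi⟩ := exists_nat_one_div_lt hpos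
      exact hcon i ⟨((s, n'), (s, n)), ⟨⟨⟨hs, hn'⟩, ⟨hs, hn⟩⟩, rfl, hi.le⟩, rfl⟩
  rw [this]
  exact hD.measurableSet.diff (MeasurableSet.iUnion hN)

lemma aemeasurable_normalMap {C : Set E3} (hC : IsConvexBody C) {D : Set E3} (hD : IsCompact D)
    (hDC : D ⊆ frontier C) (μ : Measure E3) :
    AEMeasurable (normalMap C) (μ.restrict (D ∩ {r | IsRegularPt C r})) := by
  have hm := measurable_reg hC hD hDC
  refine aemeasurable_restrict_of_measurable_subtype hm ?_
  refine measurable_of_isClosed fun F hF => ?_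
  have hcp : IsCompact (Prod.fst '' ({p : E3 × E3 | p.1 ∈ D ∧ IsOutwardNormalAt C p.1 p.2} ∩
      (Prod.snd ⁻¹' F))) :=
    ((isCompact_normal hD).inter_right (hF.preimage continuous_snd)).image continuous_fst
  have : (fun x : ↥(D ∩ {r | IsRegularPt C r}) => normalMap C x) ⁻¹' F = Subtype.val ⁻¹'
      (Prod.fst '' ({p : E3 × E3 | p.1 ∈ D ∧ IsOutwardNormalAt C p.1 p.2} ∩
      (Prod.snd ⁻¹' F))) := by
    ext ⟨s, hs, hr⟩
    simp only [mem_preimage]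
    constructor
    · intro hF'
      exact ⟨(s, normalMap C s), ⟨⟨hs, normalMap_spec hr.exists⟩, hF'⟩, rfl⟩
    · rintro ⟨⟨s', n⟩, ⟨⟨h1, h2⟩, h3⟩, h4⟩
      dsimp only at h4 h2 h3
      subst h4
      rw [hr.unique (normalMap_spec hr.exists) h2]
      exact h3
  rw [this]
  exact measurable_subtype_coe hcp.measurableSet

/-! abstract convergence -/

lemma abstract_tendsto (M : ℝ → Measure E3) (v₁ v₂ : E3) (hv : v₁ ≠ v₂) (m₁ m₂ : ℝ)
    (h1 : ∀ ε > 0, ∀ᶠ t in 𝓝[>] (0 : ℝ), ENNReal.ofReal ((m₁ - ε) * t) ≤ M t (Metric.ball v₁ ε))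
    (h2 : ∀ ε > 0, ∀ᶠ t in 𝓝[>] (0 : ℝ), ENNReal.ofReal ((m₂ - ε) * t) ≤ M t (Metric.ball v₂ ε))
    (hU : ∀ ε > 0, ∀ᶠ t in 𝓝[>] (0 : ℝ), M t univ ≤ ENNReal.ofReal ((m₁ + m₂ + ε) * t))
    (hm₁ : 0 ≤ m₁) (hm₂ : 0 ≤ m₂)
    (f : BoundedContinuousFunction E3 ℝ) :
    Tendsto (fun t => (∫ x, f x ∂(M t)) / t) (𝓝[>] (0 : ℝ)) (𝓝 (m₁ * f v₁ + m₂ * f v₂)) := by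
  rw [Metric.tendsto_nhds]
  intro ρ hρ
  set F := ‖f‖ with hF
  have hFf : ∀ x, |f x| ≤ F := fun x => f.norm_coe_le_norm x
  have hF0 : 0 ≤ F := norm_nonneg f
  -- choose ε
  set K := m₁ + m₂ + 1 + 20 * F with hK
  have hKpos : 0 < K := by positivity
  set ω := ρ / (2 * K) with hω
  have hωpos : 0 < ω := by positivity
  obtain ⟨d₁, hd₁, hd₁'⟩ := Metric.continuous_iff.1 f.continuous v₁ ω hωpos
  obtain ⟨d₂, hd₂, hd₂'⟩ := Metric.continuous_iff.1 f.continuous v₂ ω hωpos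
  have hdv : 0 < dist v₁ v₂ := dist_pos.2 hv
  set ε := min (min d₁ d₂) (min (dist v₁ v₂ / 2) (min ω 1)) with hε
  have hεpos : 0 < ε := by
    simp only [hε, lt_min_iff]
    refine ⟨⟨hd₁, hd₂⟩, by linarith, hωpos, one_pos⟩
  have e1 : ε ≤ d₁ := (min_le_left _ _).trans (min_le_left _ _)
  have e2 : ε ≤ d₂ := (min_le_left _ _).trans (min_le_right _ _)
  have e3 : ε ≤ dist v₁ v₂ / 2 := (min_le_right _ _).trans (min_le_left _ _)
  have e4 : ε ≤ ω := (min_le_right _ _).trans ((min_le_right _ _).trans (min_le_left _ _))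
  have e5 : ε ≤ 1 := (min_le_right _ _).trans ((min_le_right _ _).trans (min_le_right _ _))
  have hdisj : Disjoint (Metric.ball v₁ ε) (Metric.ball v₂ ε) :=
    Metric.ball_disjoint_ball (by linarith)
  filter_upwards [h1 ε hεpos, h2 ε hεpos, hU ε hεpos, self_mem_nhdsWithin] with t a1 a2 aU ht
  have ht : 0 < t := ht
  have hfin : IsFiniteMeasure (M t) := ⟨lt_of_le_of_lt aU ENNReal.ofReal_lt_top⟩
  set A := Metric.ball v₁ ε with hA
  set B := Metric.ball v₂ ε with hB
  have mA : MeasurableSet A := Metric.isOpen_ball.measurableSet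
  have mB : MeasurableSet B := Metric.isOpen_ball.measurableSet
  set R := (A ∪ B)ᶜ with hR
  have mR : MeasurableSet R := (mA.union mB).compl
  have hint : ∀ S : Set E3, IntegrableOn (fun x => f x) S (M t) := fun S =>
    (f.integrable (M t)).integrableOn
  set xA := (M t).real A with hxA
  set xB := (M t).real B with hxB
  set xR := (M t).real R with hxR
  have b1 : (m₁ - ε) * t ≤ xA := by
    rw [hxA, Measure.real]
    exact (ENNReal.ofReal_le_iff_le_toReal (measure_ne_top _ _)).1 a1
  have b2 : (m₂ - ε) * t ≤ xB := by
    rw [hxB, Measure.real]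
    exact (ENNReal.ofReal_le_iff_le_toReal (measure_ne_top _ _)).1 a2
  have hsum : xA + xB + xR ≤ (m₁ + m₂ + ε) * t := by
    have c1 : xA + xB = (M t).real (A ∪ B) := (measureReal_union hdisj mB).symm
    have c2 : (M t).real (A ∪ B) + xR = (M t).real univ := measureReal_add_measureReal_compl (mA.union mB)
    rw [c1, c2, Measure.real]
    exact ENNReal.toReal_le_of_le_ofReal (by positivity) aU
  have hxA0 : 0 ≤ xA := measureReal_nonneg
  have hxB0 : 0 ≤ xB := measureReal_nonneg
  have hxR0 : 0 ≤ xR := measureReal_nonneg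
  have hsplit : ∫ x, f x ∂(M t) = (∫ x in A, f x ∂(M t)) + (∫ x in B, f x ∂(M t)) +
      ∫ x in R, f x ∂(M t) := by
    rw [← setIntegral_union hdisj mB (hint _) (hint _),
      integral_add_compl (mA.union mB) (f.integrable (M t))]
  have piece : ∀ S : Set E3, MeasurableSet S → ∀ cc b : ℝ, (∀ x ∈ S, |f x - cc| ≤ b) →
      |(∫ x in S, f x ∂(M t)) - cc * (M t).real S| ≤ b * (M t).real S := by
    intro S mS cc b hb
    have c1 : (∫ x in S, f x ∂(M t)) - cc * (M t).real S = ∫ x in S, (f x - cc) ∂(M t) := by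
      rw [integral_sub (hint S) (integrable_const _), setIntegral_const, smul_eq_mul, mul_comm]
    rw [c1]
    have c2 := norm_setIntegral_le_of_norm_le_const (f := fun x => f x - cc) (C := b)
      (measure_lt_top (M t) S) (fun x hx => hb x hx)
    exact c2
  have pA := piece A mA (f v₁) ω (fun x hx => by
    have := hd₁' x ((Metric.mem_ball.1 hx).trans_le e1)
    rw [Real.dist_eq] at this; exact this.le)
  have pB := piece B mB (f v₂) ω (fun x hx => by
    have := hd₂' x ((Metric.mem_ball.1 hx).trans_le e2)
    rw [Real.dist_eq] at this; exact this.le)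
  have pR := piece R mR 0 F (fun x hx => by simpa using hFf x)
  rw [← hxA] at pA
  rw [← hxB] at pB
  rw [← hxR, zero_mul, sub_zero] at pR
  rw [Real.dist_eq]
  have hε_t : 0 ≤ ε * t := by positivity
  have q1 : |xA - m₁ * t| ≤ 2 * (ε * t) + ε * t := by
    rw [abs_le]; constructor <;> nlinarith
  have q2 : |xB - m₂ * t| ≤ 2 * (ε * t) + ε * t := by
    rw [abs_le]; constructor <;> nlinarith
  have q3 : xR ≤ 3 * (ε * t) := by linarith
  have hmain : |∫ x, f x ∂(M t) - (m₁ * f v₁ + m₂ * f v₂) * t| ≤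
      ω * (xA + xB) + F * xR + F * |xA - m₁ * t| + F * |xB - m₂ * t| := by
    rw [hsplit]
    have r1 : |f v₁ * (xA - m₁ * t)| ≤ F * |xA - m₁ * t| := by
      rw [abs_mul]; exact mul_le_mul_of_nonneg_right (hFf _) (abs_nonneg _)
    have r2 : |f v₂ * (xB - m₂ * t)| ≤ F * |xB - m₂ * t| := by
      rw [abs_mul]; exact mul_le_mul_of_nonneg_right (hFf _) (abs_nonneg _)
    rw [abs_le] at *
    constructor <;> linarith [pA.1, pA.2, pB.1, pB.2, pR.1, pR.2, r1.1, r1.2, r2.1, r2.2]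
  have hb : ω * (xA + xB) + F * xR + F * |xA - m₁ * t| + F * |xB - m₂ * t| ≤ (ω * K) * t := by
    have s0 : ε * t ≤ 1 * t := mul_le_mul_of_nonneg_right e5 ht.le
    have s1 : xA + xB ≤ (m₁ + m₂ + 1) * t := by linarith
    have s2 : ω * (xA + xB) ≤ ω * ((m₁ + m₂ + 1) * t) := by gcongr
    have s3 : F * xR + F * |xA - m₁ * t| + F * |xB - m₂ * t| ≤ F * (9 * (ε * t)) := by
      have : F * xR + F * |xA - m₁ * t| + F * |xB - m₂ * t| =
        F * (xR + |xA - m₁ * t| + |xB - m₂ * t|) := by ring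
      rw [this]
      gcongr
      linarith
    have s4 : F * (9 * (ε * t)) ≤ F * (20 * (ω * t)) := by
      have := mul_le_mul_of_nonneg_right e4 ht.le
      refine mul_le_mul_of_nonneg_left ?_ hF0
      have : 0 ≤ ω * t := by positivity
      linarith
    have s5 : ω * K * t = ω * ((m₁ + m₂ + 1) * t) + F * (20 * (ω * t)) := by rw [hK]; ring
    linarith
  have hωK : ω * K = ρ / 2 := by rw [hω]; field_simp
  have hlast : (∫ x, f x ∂(M t)) / t - (m₁ * f v₁ + m₂ * f v₂) =
      (∫ x, f x ∂(M t) - (m₁ * f v₁ + m₂ * f v₂) * t) / t := by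
    field_simp
  rw [hlast, abs_div, abs_of_pos ht, div_lt_iff₀ ht]
  rw [hωK] at hb
  have : 0 < ρ / 2 * t := by positivity
  linarith
structure Frame (e₁ e₂ e₃ f₁ f₂ : E3) (c s : ℝ) : Prop where
  h11 : ⟪e₁, e₁⟫ = 1
  h22 : ⟪e₂, e₂⟫ = 1
  h33 : ⟪e₃, e₃⟫ = 1
  h12 : ⟪e₁, e₂⟫ = c
  h13 : ⟪e₁, e₃⟫ = 0
  h23 : ⟪e₂, e₃⟫ = 0
  hs : 0 < s
  hsc : s ^ 2 = 1 - c ^ 2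
  hf₁ : f₁ = (1 / s ^ 2) • (e₁ - c • e₂)
  hf₂ : f₂ = (1 / s ^ 2) • (e₂ - c • e₁)
  exp : ∀ v : E3, v = ⟪v, e₁⟫ • f₁ + ⟪v, e₂⟫ • f₂ + ⟪v, e₃⟫ • e₃

namespace Frame
variable {e₁ e₂ e₃ f₁ f₂ : E3} {c s : ℝ}

lemma swap (F : Frame e₁ e₂ e₃ f₁ f₂ c s) : Frame e₂ e₁ e₃ f₂ f₁ c s where
  h11 := F.h22
  h22 := F.h11
  h33 := F.h33
  h12 := by rw [real_inner_comm]; exact F.h12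
  h13 := F.h23
  h23 := F.h13
  hs := F.hs
  hsc := F.hsc
  hf₁ := F.hf₂
  hf₂ := F.hf₁
  exp := fun v => by
    conv_lhs => rw [F.exp v]
    abel

lemma inner_f1 (F : Frame e₁ e₂ e₃ f₁ f₂ c s) (v : E3) :
    ⟪v, f₁⟫ = (⟪v, e₁⟫ - c * ⟪v, e₂⟫) / s ^ 2 := by
  rw [F.hf₁, inner_smul_right, inner_sub_right, inner_smul_right]; ring

lemma inner_f2 (F : Frame e₁ e₂ e₃ f₁ f₂ c s) (v : E3) :
    ⟪v, f₂⟫ = (⟪v, e₂⟫ - c * ⟪v, e₁⟫) / s ^ 2 := F.swap.inner_f1 v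

lemma f11 (F : Frame e₁ e₂ e₃ f₁ f₂ c s) : ⟪f₁, e₁⟫ = 1 := by
  have h0 : s ^ 2 ≠ 0 := (pow_pos F.hs 2).ne'
  rw [real_inner_comm, F.inner_f1, F.h11, F.h12, div_eq_one_iff_eq h0, F.hsc]; ring
lemma f12 (F : Frame e₁ e₂ e₃ f₁ f₂ c s) : ⟪f₁, e₂⟫ = 0 := by
  rw [real_inner_comm, F.inner_f1, F.swap.h12, F.h22]; simp
lemma f13 (F : Frame e₁ e₂ e₃ f₁ f₂ c s) : ⟪f₁, e₃⟫ = 0 := by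
  rw [real_inner_comm, F.inner_f1, real_inner_comm, F.h13, real_inner_comm, F.h23]; simp
lemma f22 (F : Frame e₁ e₂ e₃ f₁ f₂ c s) : ⟪f₂, e₂⟫ = 1 := F.swap.f11
lemma f21 (F : Frame e₁ e₂ e₃ f₁ f₂ c s) : ⟪f₂, e₁⟫ = 0 := F.swap.f12
lemma f23 (F : Frame e₁ e₂ e₃ f₁ f₂ c s) : ⟪f₂, e₃⟫ = 0 := F.swap.f13
lemma h31 (F : Frame e₁ e₂ e₃ f₁ f₂ c s) : ⟪e₃, e₁⟫ = 0 := by rw [real_inner_comm, F.h13]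
lemma h32 (F : Frame e₁ e₂ e₃ f₁ f₂ c s) : ⟪e₃, e₂⟫ = 0 := by rw [real_inner_comm, F.h23]

lemma normsq (F : Frame e₁ e₂ e₃ f₁ f₂ c s) (v : E3) :
    ‖v‖ ^ 2 = (⟪v, e₁⟫ ^ 2 + ⟪v, e₂⟫ ^ 2 - 2 * c * ⟪v, e₁⟫ * ⟪v, e₂⟫) / s ^ 2 + ⟪v, e₃⟫ ^ 2 := by
  have h : ⟪v, v⟫ = ⟪v, ⟪v, e₁⟫ • f₁ + ⟪v, e₂⟫ • f₂ + ⟪v, e₃⟫ • e₃⟫ :=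
    congrArg (fun w => ⟪v, w⟫) (F.exp v)
  rw [inner_add_right, inner_add_right, inner_smul_right, inner_smul_right, inner_smul_right,
    F.inner_f1, F.inner_f2] at h
  rw [← real_inner_self_eq_norm_sq, h]
  ring

/-- rotated vector -/
lemma ont (F : Frame e₁ e₂ e₃ f₁ f₂ c s) (l₁ l₂ : ℝ) (h : l₁ ^ 2 + l₂ ^ 2 + 2 * c * l₁ * l₂ = 1) :
    ONT (l₁ • e₁ + l₂ • e₂) ((1 / s) • ((l₁ + c * l₂) • e₂ - (l₁ * c + l₂) • e₁)) e₃ := by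
  intro v
  have h0 : s ≠ 0 := F.hs.ne'
  rw [F.normsq v]
  simp only [inner_add_right, inner_smul_right, inner_sub_right]
  field_simp
  rw [F.hsc]
  linear_combination (-⟪v, e₁⟫ ^ 2 - ⟪v, e₂⟫ ^ 2 + 2 * c * ⟪v, e₁⟫ * ⟪v, e₂⟫) * h

lemma ont1 (F : Frame e₁ e₂ e₃ f₁ f₂ c s) :
    ONT e₁ ((1 / s) • (e₂ - c • e₁)) e₃ := by
  have := F.ont 1 0 (by ring)
  simpa using this

lemma c_le (F : Frame e₁ e₂ e₃ f₁ f₂ c s) : |c| ≤ 1 := by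
  have := F.hsc
  have := sq_nonneg s
  rw [abs_le]; constructor <;> nlinarith

/-- dual expansion of a normal -/
lemma dual (F : Frame e₁ e₂ e₃ f₁ f₂ c s) (n : E3) :
    n = ⟪f₁, n⟫ • e₁ + ⟪f₂, n⟫ • e₂ + ⟪e₃, n⟫ • e₃ := by
  refine ext_inner_left ℝ fun v => ?_
  conv_lhs => rw [F.exp v]
  simp only [inner_add_right, inner_add_left, inner_smul_left, inner_smul_right,
    RCLike.conj_to_real]
  ring

end Frame

/-- point with given oblique coordinates -/
def pt (r₀ f₁ f₂ e₃ : E3) (α β x : ℝ) : E3 := r₀ + (α • f₁ + β • f₂ + x • e₃)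

section
variable {r₀ e₁ e₂ e₃ f₁ f₂ : E3} {c s : ℝ}

lemma pt_e1 (F : Frame e₁ e₂ e₃ f₁ f₂ c s) (α β x : ℝ) :
    ⟪pt r₀ f₁ f₂ e₃ α β x - r₀, e₁⟫ = α := by
  simp [pt, inner_add_left, inner_smul_left, F.f11, F.f21, F.h31]
lemma pt_e2 (F : Frame e₁ e₂ e₃ f₁ f₂ c s) (α β x : ℝ) :
    ⟪pt r₀ f₁ f₂ e₃ α β x - r₀, e₂⟫ = β := by
  simp [pt, inner_add_left, inner_smul_left, F.f12, F.f22, F.h32]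
lemma pt_e3 (F : Frame e₁ e₂ e₃ f₁ f₂ c s) (α β x : ℝ) :
    ⟪pt r₀ f₁ f₂ e₃ α β x - r₀, e₃⟫ = x := by
  simp only [pt, add_sub_cancel_left, inner_add_left, real_inner_smul_left, F.f13, F.f23, F.h33]
  ring
lemma pt_eq (F : Frame e₁ e₂ e₃ f₁ f₂ c s) (r : E3) :
    r = pt r₀ f₁ f₂ e₃ ⟪r - r₀, e₁⟫ ⟪r - r₀, e₂⟫ ⟪r - r₀, e₃⟫ := by
  rw [pt, ← F.exp (r - r₀)]; abel
end

structure Setup (C : Set E3) (r₀ e₁ e₂ e₃ f₁ f₂ : E3) (c s a b : ℝ) : Prop where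
  fr : Frame e₁ e₂ e₃ f₁ f₂ c s
  body : IsConvexBody C
  hab : a < b
  neg1 : ∀ r ∈ C, ⟪r - r₀, e₁⟫ ≤ 0
  neg2 : ∀ r ∈ C, ⟪r - r₀, e₂⟫ ≤ 0
  inn : ∀ ε > 0, ∀ η, 0 < η → η < 1 → ∃ τ > 0, ∀ α β x : ℝ, α ≤ η * β → β ≤ η * α → -τ ≤ α →
    -τ ≤ β → a + ε ≤ x → x ≤ b - ε → pt r₀ f₁ f₂ e₃ α β x ∈ C
  out : ∀ ε > 0, ∃ τ > 0, ∀ r ∈ C, -τ ≤ ⟪r - r₀, e₁⟫ → -τ ≤ ⟪r - r₀, e₂⟫ →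
    ⟪r - r₀, e₃⟫ ∈ Icc (a - ε) (b + ε)

namespace Setup
variable {C : Set E3} {r₀ e₁ e₂ e₃ f₁ f₂ : E3} {c s a b : ℝ}

lemma swap (H : Setup C r₀ e₁ e₂ e₃ f₁ f₂ c s a b) : Setup C r₀ e₂ e₁ e₃ f₂ f₁ c s a b where
  fr := H.fr.swap
  body := H.body
  hab := H.hab
  neg1 := H.neg2
  neg2 := H.neg1
  inn := by
    intro ε hε η h0 h1
    obtain ⟨τ, hτ, h⟩ := H.inn ε hε η h0 h1
    refine ⟨τ, hτ, fun α β x c1 c2 c3 c4 c5 c6 => ?_⟩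
    have := h β α x c2 c1 c4 c3 c5 c6
    rwa [pt, add_comm (β • f₁), ← pt] at this
  out := by
    intro ε hε
    obtain ⟨τ, hτ, h⟩ := H.out ε hε
    exact ⟨τ, hτ, fun r hr h1 h2 => h r hr h2 h1⟩

lemma dichotomy (H : Setup C r₀ e₁ e₂ e₃ f₁ f₂ c s a b) {ε η : ℝ} (hε : 0 < ε) (h0 : 0 < η)
    (h1 : η < 1) : ∃ τ > 0, ∀ r ∈ frontier C, -τ ≤ ⟪r - r₀, e₁⟫ → -τ ≤ ⟪r - r₀, e₂⟫ →
      ⟪r - r₀, e₃⟫ ∈ Icc (a + 2 * ε) (b - 2 * ε) →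
      η * ⟪r - r₀, e₂⟫ ≤ ⟪r - r₀, e₁⟫ ∨ η * ⟪r - r₀, e₁⟫ ≤ ⟪r - r₀, e₂⟫ := by
  obtain ⟨τ, hτ, h⟩ := H.inn ε hε η h0 h1
  refine ⟨τ / 2, by positivity, fun r hr a1 a2 a3 => ?_⟩
  by_contra hcon
  push Not at hcon
  obtain ⟨b1, b2⟩ := hcon
  let U : Set E3 := {r | ⟪r - r₀, e₁⟫ < η * ⟪r - r₀, e₂⟫} ∩ {r | ⟪r - r₀, e₂⟫ < η * ⟪r - r₀, e₁⟫} ∩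
    {r | -τ < ⟪r - r₀, e₁⟫} ∩ {r | -τ < ⟪r - r₀, e₂⟫} ∩ {r | a + ε < ⟪r - r₀, e₃⟫} ∩
    {r | ⟪r - r₀, e₃⟫ < b - ε}
  have hU : IsOpen U := by
    refine ((((IsOpen.inter ?_ ?_).inter ?_).inter ?_).inter ?_).inter ?_ <;>
    exact isOpen_lt (by fun_prop) (by fun_prop)
  have hUC : U ⊆ C := by
    rintro y ⟨⟨⟨⟨⟨c1, c2⟩, c3⟩, c4⟩, c5⟩, c6⟩
    rw [pt_eq (r₀ := r₀) H.fr y]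
    exact h _ _ _ (le_of_lt c1) (le_of_lt c2) (le_of_lt c3) (le_of_lt c4) (le_of_lt c5)
      (le_of_lt c6)
  have hrU : r ∈ U := by
    refine ⟨⟨⟨⟨⟨b1, b2⟩, ?_⟩, ?_⟩, ?_⟩, ?_⟩ <;> simp only [mem_ofPred_eq] <;>
      linarith [a3.1, a3.2]
  have hint : r ∈ interior C := mem_interior.2 ⟨U, hUC, hU, hrU⟩
  rw [frontier] at hr
  exact hr.2 hint

set_option maxHeartbeats 1000000 in
lemma normals (H : Setup C r₀ e₁ e₂ e₃ f₁ f₂ c s a b) {ε : ℝ} (hε : 0 < ε) :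
    ∃ η₀ > 0, ∀ η, 0 < η → η ≤ η₀ → ∀ ε' > 0, ∃ τ > 0, ∀ r ∈ C,
      ⟪r - r₀, e₃⟫ ∈ Icc (a + 2 * ε') (b - 2 * ε') →
      η * ⟪r - r₀, e₂⟫ ≤ ⟪r - r₀, e₁⟫ → -τ ≤ ⟪r - r₀, e₂⟫ → ⟪r - r₀, e₂⟫ < 0 →
      ∀ n, IsOutwardNormalAt C r n → ‖n - e₁‖ ≤ ε := by
  set K := ‖f₁‖ with hK
  have hK0 : 0 ≤ K := norm_nonneg _
  refine ⟨min (1 / 2) (ε / (8 * (K + 1))), by positivity, ?_⟩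
  intro η h0 hη ε' hε'
  have hη1 : η ≤ 1 / 2 := hη.trans (min_le_left _ _)
  have hη2 : η * (8 * (K + 1)) ≤ ε := by
    rw [← le_div_iff₀ (by positivity)]; exact hη.trans (min_le_right _ _)
  obtain ⟨τ, hτ, h⟩ := H.inn ε' hε' η h0 (by linarith)
  refine ⟨min (τ / 2) ε', by positivity, ?_⟩
  intro r hr hx hαβ hβτ hβ n hn
  have hα := H.neg1 r hr
  have hre := pt_eq (r₀ := r₀) H.fr r
  set α := ⟪r - r₀, e₁⟫ with hαdef
  set β := ⟪r - r₀, e₂⟫ with hβdef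
  set x := ⟪r - r₀, e₃⟫ with hxdef
  have hβ1 : -(τ / 2) ≤ β := by
    have := min_le_left (τ / 2) ε'; linarith
  have hβ2 : -ε' ≤ β := by
    have := min_le_right (τ / 2) ε'; linarith
  obtain ⟨hx1, hx2⟩ := hx
  set νa := ⟪f₁, n⟫ with hνa
  set νb := ⟪f₂, n⟫ with hνb
  set νx := ⟪e₃, n⟫ with hνx
  have key : ∀ α' β' x', pt r₀ f₁ f₂ e₃ α' β' x' ∈ C →
      (α' - α) * νa + (β' - β) * νb + (x' - x) * νx ≤ 0 := by
    intro α' β' x' hy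
    have h1 := hn.2 _ hy
    have e : pt r₀ f₁ f₂ e₃ α' β' x' - r = (α' - α) • f₁ + (β' - β) • f₂ + (x' - x) • e₃ := by
      conv_lhs => rw [hre]
      simp only [pt, sub_smul]; abel
    rw [e] at h1
    simpa [inner_add_left, inner_smul_left] using h1
  have hηβ : η * β < 0 := mul_neg_of_pos_of_neg h0 hβ
  have hηηβ : β ≤ η * (η * β) := by nlinarith
  have y1 := key (2 * (η * β)) (2 * β) x (h _ _ _ (by linarith) (by linarith) (by nlinarith)
    (by linarith) (by linarith) (by linarith))
  have y2 := key (η * β / 2) (β / 2) x (h _ _ _ (by linarith) (by linarith) (by nlinarith)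
    (by linarith) (by linarith) (by linarith))
  have y3 := key (η * β) β (x + ε') (h _ _ _ (by linarith) (by linarith) (by nlinarith)
    (by linarith) (by linarith) (by linarith))
  have y3' := key (η * β) β (x - ε') (h _ _ _ (by linarith) (by linarith) (by nlinarith)
    (by linarith) (by linarith) (by linarith))
  have y4 := key β β x (h _ _ _ (by nlinarith) (by nlinarith) (by linarith)
    (by linarith) (by linarith) (by linarith))
  have hνa0 : 0 ≤ νa := by
    have : β - α < 0 := by nlinarith
    by_contra hneg
    push Not at hneg
    nlinarith
  have hανa : α * νa ≤ 0 := mul_nonpos_of_nonpos_of_nonneg hα hνa0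
  have z1 : -(2 * η * νa) ≤ νb := by
    have : β * νb ≤ β * (-(2 * η * νa)) := by linarith
    exact (mul_le_mul_left_of_neg hβ).1 this
  have z2 : νb ≤ 2 * η * νa := by
    have : β * (η * νa) ≤ β * νb := by linarith
    have h5 := (mul_le_mul_left_of_neg hβ).1 this
    have : 0 ≤ η * νa := by positivity
    linarith
  have hb3 : -(η * β * νa) ≤ ε' * (η * νa) := by
    have h7 : 0 ≤ η * νa := by positivity
    have h8 := mul_le_mul_of_nonneg_right (show -β ≤ ε' by linarith) h7
    linarith
  have z3 : νx ≤ η * νa := by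
    have : ε' * νx ≤ ε' * (η * νa) := by linarith
    exact le_of_mul_le_mul_left this hε'
  have z4 : -(η * νa) ≤ νx := by
    have : ε' * (-(η * νa)) ≤ ε' * νx := by linarith
    exact le_of_mul_le_mul_left this hε'
  have hνaK : νa ≤ K := by
    have := real_inner_le_norm f₁ n
    rw [hn.1, mul_one] at this
    exact this
  have ne1 : ‖e₁‖ = 1 := by
    have := H.fr.h11
    rw [real_inner_self_eq_norm_sq] at this
    nlinarith [norm_nonneg e₁]
  have ne2 : ‖e₂‖ = 1 := by
    have := H.fr.h22
    rw [real_inner_self_eq_norm_sq] at this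
    nlinarith [norm_nonneg e₂]
  have ne3 : ‖e₃‖ = 1 := by
    have := H.fr.h33
    rw [real_inner_self_eq_norm_sq] at this
    nlinarith [norm_nonneg e₃]
  have hd : ‖n - νa • e₁‖ ≤ 3 * (η * νa) := by
    have e : n - νa • e₁ = νb • e₂ + νx • e₃ := by
      conv_lhs => rw [H.fr.dual n]
      abel
    rw [e]
    refine (norm_add_le _ _).trans ?_
    rw [norm_smul, norm_smul, ne2, ne3, Real.norm_eq_abs, Real.norm_eq_abs]
    have a1 : |νb| ≤ 2 * η * νa := abs_le.2 ⟨z1, z2⟩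
    have a2 : |νx| ≤ η * νa := abs_le.2 ⟨z4, z3⟩
    linarith
  have hd2 : ‖νa • e₁ - e₁‖ ≤ 3 * (η * νa) := by
    have e : νa • e₁ - e₁ = (νa - 1) • e₁ := by rw [sub_smul, one_smul]
    rw [e, norm_smul, ne1, mul_one, Real.norm_eq_abs]
    have h6 := abs_norm_sub_norm_le n (νa • e₁)
    rw [hn.1, norm_smul, ne1, mul_one, Real.norm_of_nonneg hνa0, abs_sub_comm] at h6
    exact h6.trans hd
  have : ‖n - e₁‖ ≤ 6 * (η * νa) := by
    have e : n - e₁ = (n - νa • e₁) + (νa • e₁ - e₁) := by abel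
    rw [e]
    exact (norm_add_le _ _).trans (by linarith)
  have : η * νa ≤ η * K := by gcongr
  nlinarith

end Setup

namespace Setup
variable {C : Set E3} {r₀ e₁ e₂ e₃ f₁ f₂ : E3} {c s a b : ℝ}

lemma inner_ge_half (H : Setup C r₀ e₁ e₂ e₃ f₁ f₂ c s a b) {n : E3} {ε : ℝ}
    (h : ‖n - e₁‖ ≤ ε) : 1 - ε ≤ ⟪n, e₁⟫ := by
  have ne1 : ‖e₁‖ = 1 := by
    have := H.fr.h11
    rw [real_inner_self_eq_norm_sq] at this
    nlinarith [norm_nonneg e₁]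
  have h1 := abs_real_inner_le_norm (n - e₁) e₁
  rw [ne1, mul_one, inner_sub_left, H.fr.h11] at h1
  have := (abs_le.1 (h1.trans h)).1
  linarith

lemma closedC (H : Setup C r₀ e₁ e₂ e₃ f₁ f₂ c s a b) : IsClosed C := H.body.1.isClosed

/-- topmost point on a line -/
lemma top_point (H : Setup C r₀ e₁ e₂ e₃ f₁ f₂ c s a b) {α₀ β₀ x : ℝ}
    (hP : pt r₀ f₁ f₂ e₃ α₀ (β₀ + c * α₀) x ∈ C) :
    ∃ α, α₀ ≤ α ∧ α ≤ 0 ∧ pt r₀ f₁ f₂ e₃ α (β₀ + c * α) x ∈ frontier C := by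
  set P : ℝ → E3 := fun α => pt r₀ f₁ f₂ e₃ α (β₀ + c * α) x with hPdef
  have hcont : Continuous P := by
    simp only [hPdef, pt]; fun_prop
  have hα0 : α₀ ≤ 0 := by
    have := H.neg1 _ hP; rwa [pt_e1 H.fr] at this
  have hcomp : IsCompact (Icc α₀ 0 ∩ P ⁻¹' C) :=
    isCompact_Icc.inter_right (H.closedC.preimage hcont)
  obtain ⟨α, hα, hmax⟩ := hcomp.exists_isMaxOn ⟨α₀, ⟨le_refl _, hα0⟩, hP⟩ continuousOn_id
  refine ⟨α, hα.1.1, hα.1.2, ?_⟩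
  rw [frontier, H.closedC.closure_eq]
  refine ⟨hα.2, fun hint => ?_⟩
  have h1 : ∀ᶠ y in 𝓝 α, P y ∈ C := by
    have := hcont.continuousAt (x := α) (mem_interior_iff_mem_nhds.1 hint)
    exact this
  have h2 : ∀ᶠ y in 𝓝[>] α, P y ∈ C ∧ α < y :=
    (h1.filter_mono nhdsWithin_le_nhds).and self_mem_nhdsWithin
  obtain ⟨y, hy, hαy⟩ := h2.exists
  have hy0 : y ≤ 0 := by
    have := H.neg1 _ hy; rwa [hPdef, pt_e1 H.fr] at this
  have : y ≤ α := hmax ⟨⟨hα.1.1.trans hαy.le, hy0⟩, hy⟩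
  linarith

/-- the good part of the boundary near the first face -/
def good (C : Set E3) (r₀ e₁ e₂ : E3) (l₁ l₂ ε t : ℝ) : Set E3 :=
  {r | r ∈ frontier C ∧ -t ≤ l₁ * ⟪r - r₀, e₁⟫ + l₂ * ⟪r - r₀, e₂⟫ ∧ IsRegularPt C r ∧
    ‖normalMap C r - e₁‖ ≤ ε}

set_option maxHeartbeats 1000000 in
lemma rect_in (H : Setup C r₀ e₁ e₂ e₃ f₁ f₂ c s a b) {l₁ l₂ ε : ℝ} (hl₁ : 0 < l₁)
    (hl₂ : 0 < l₂) (hε : 0 < ε) (hε1 : ε < 1 / 2) :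
    ∃ τ > 0, ∀ t, 0 < t → t ≤ τ → ∀ β₀ x, -((1 - ε) * t / l₂) ≤ β₀ → β₀ ≤ -(ε * t / l₂) →
      a + 2 * ε ≤ x → x ≤ b - 2 * ε → ∃ r ∈ frontier C,
        -t ≤ l₁ * ⟪r - r₀, e₁⟫ + l₂ * ⟪r - r₀, e₂⟫ ∧
        ⟪r - r₀, e₂⟫ - c * ⟪r - r₀, e₁⟫ = β₀ ∧ ⟪r - r₀, e₃⟫ = x ∧
        ∀ n, IsOutwardNormalAt C r n → ‖n - e₁‖ ≤ ε := by
  obtain ⟨η₀, hη₀, hN⟩ := H.normals hε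
  set K := l₁ / l₂ + 1 with hK
  have hK0 : 0 < K := by positivity
  obtain ⟨η, h0, hη1, hη2, hη3⟩ : ∃ η, 0 < η ∧ 4 * η ≤ η₀ ∧ η ≤ 1 / 16 ∧ 2 * η * K ≤ ε := by
    refine ⟨min (min (η₀ / 4) (1 / 16)) (ε / (2 * K)), by positivity, ?_, ?_, ?_⟩
    · have : min (min (η₀ / 4) (1 / 16)) (ε / (2 * K)) ≤ η₀ / 4 :=
        (min_le_left _ _).trans (min_le_left _ _)
      linarith
    · exact (min_le_left _ _).trans (min_le_right _ _)
    · have : min (min (η₀ / 4) (1 / 16)) (ε / (2 * K)) ≤ ε / (2 * K) := min_le_right _ _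
      rw [le_div_iff₀ (by positivity)] at this
      linarith
  obtain ⟨τ₁, hτ₁, hin⟩ := H.inn ε hε η h0 (by linarith)
  obtain ⟨τ₂, hτ₂, hno⟩ := hN (4 * η) (by positivity) hη1 ε hε
  have hc := abs_le.1 H.fr.c_le
  refine ⟨min (τ₁ * l₂ / 2) (τ₂ * l₂ / 2), by positivity, ?_⟩
  intro t ht htτ β₀ x hb1 hb2 hx1 hx2
  have ht1 : t / l₂ ≤ τ₁ / 2 := by
    rw [div_le_iff₀ hl₂]
    have := htτ.trans (min_le_left _ _); linarith
  have ht2 : t / l₂ ≤ τ₂ / 2 := by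
    rw [div_le_iff₀ hl₂]
    have := htτ.trans (min_le_right _ _); linarith
  have htl : 0 < t / l₂ := by positivity
  have hβlow : -(t / l₂) ≤ β₀ := by
    have : (1 - ε) * t / l₂ = t / l₂ - ε * (t / l₂) := by ring
    have : 0 < ε * (t / l₂) := by positivity
    linarith
  have hβneg : β₀ < 0 := by
    have : 0 < ε * t / l₂ := by positivity
    linarith
  set w := η * β₀ with hw
  have hw0 : w < 0 := mul_neg_of_pos_of_neg h0 hβneg
  have hw1 : β₀ ≤ 16 * w := by
    have := mul_le_mul_of_nonpos_right hη2 hβneg.le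
    linarith
  have hcw : |c * (2 * w)| ≤ - (2 * w) := by
    rw [abs_mul, abs_of_neg (show 2 * w < 0 by linarith)]
    exact mul_le_of_le_one_left (by linarith) H.fr.c_le
  have hcw' := abs_le.1 hcw
  have hP : pt r₀ f₁ f₂ e₃ (2 * w) (β₀ + c * (2 * w)) x ∈ C := by
    apply hin
    · have h3 : β₀ ≤ β₀ + c * (2 * w) - 2 * w := by linarith
      have h4 : η * (β₀ + 2 * w) ≤ η * (β₀ + c * (2 * w)) :=
        mul_le_mul_of_nonneg_left (by linarith) h0.le
      have h5 : w ≤ η * (2 * w) := by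
        have := mul_le_mul_of_nonpos_right hη2 hw0.le
        linarith
      linarith
    · have h5 : w ≤ η * (2 * w) := by
        have := mul_le_mul_of_nonpos_right hη2 hw0.le
        linarith
      linarith
    · linarith
    · linarith
    · linarith
    · linarith
  obtain ⟨α, hα1, hα2, hfr⟩ := H.top_point hP
  have hcα : |c * α| ≤ - α := by
    rw [abs_mul, abs_of_nonpos hα2]
    exact mul_le_of_le_one_left (by linarith) H.fr.c_le
  have hcα' := abs_le.1 hcα
  have hmem : pt r₀ f₁ f₂ e₃ α (β₀ + c * α) x ∈ C := H.closedC.frontier_subset hfr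
  have hnn := hno _ hmem
  simp only [pt_e1 H.fr, pt_e2 H.fr, pt_e3 H.fr] at hnn
  refine ⟨_, hfr, ?_, ?_, pt_e3 H.fr _ _ _, hnn ⟨hx1, hx2⟩ ?_ ?_ ?_⟩
  · rw [pt_e1 H.fr, pt_e2 H.fr]
    have g1 : l₁ * (2 * w) ≤ l₁ * α := mul_le_mul_of_nonneg_left hα1 hl₁.le
    have g2 : l₂ * (β₀ + 2 * w) ≤ l₂ * (β₀ + c * α) :=
      mul_le_mul_of_nonneg_left (by linarith) hl₂.le
    have g3 : l₁ * (2 * w) + l₂ * (β₀ + 2 * w) = (l₂ * β₀) * (1 + 2 * η * K) := by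
      rw [hK, hw]; field_simp; ring
    have g4 : -((1 - ε) * t) ≤ l₂ * β₀ := by
      have := mul_le_mul_of_nonneg_left hb1 hl₂.le
      have h9 : l₂ * -((1 - ε) * t / l₂) = -((1 - ε) * t) := by field_simp
      linarith
    have g5 : l₂ * β₀ ≤ 0 := (mul_neg_of_pos_of_neg hl₂ hβneg).le
    have g6 : (l₂ * β₀) * (1 + ε) ≤ (l₂ * β₀) * (1 + 2 * η * K) :=
      mul_le_mul_of_nonpos_left (by linarith) g5
    have g7 : -((1 - ε) * t) * (1 + ε) ≤ (l₂ * β₀) * (1 + ε) :=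
      mul_le_mul_of_nonneg_right g4 (by linarith)
    have g8 : 0 ≤ ε ^ 2 * t := by positivity
    linarith
  · rw [pt_e1 H.fr, pt_e2 H.fr]; ring
  · have : η * (β₀ + c * α) ≤ η * (β₀ / 2) := mul_le_mul_of_nonneg_left (by linarith) h0.le
    linarith
  · linarith
  · linarith

lemma lower (H : Setup C r₀ e₁ e₂ e₃ f₁ f₂ c s a b) {l₁ l₂ ε : ℝ} (hl₁ : 0 < l₁)
    (hl₂ : 0 < l₂) (hε : 0 < ε) (hε1 : ε < 1 / 2) (hε2 : 4 * ε < b - a) :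
    ∃ τ > 0, ∀ t, 0 < t → t ≤ τ →
      ENNReal.ofReal (kap * (((1 - 2 * ε) * t / (l₂ * s)) * (b - a - 4 * ε))) ≤
        μH[2] (good C r₀ e₁ e₂ l₁ l₂ ε t) := by
  obtain ⟨τ, hτ, h⟩ := H.rect_in hl₁ hl₂ hε hε1
  refine ⟨τ, hτ, fun t ht htτ => ?_⟩
  have hs := H.fr.hs
  have hT : 0 < t / (l₂ * s) := by positivity
  set j := (1 / s) • (e₂ - c • e₁) with hj
  have hont : ONT e₁ j e₃ := H.fr.ont1
  set N' : Set E3 := {r | r ∈ C ∧ ∃ n n', n ≠ n' ∧ IsOutwardNormalAt C r n ∧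
    IsOutwardNormalAt C r n' ∧ 1 / 2 ≤ ⟪n, e₁⟫ ∧ 1 / 2 ≤ ⟪n', e₁⟫} with hN'
  have hnull : μH[2] (Qp r₀ j e₃ '' N') = 0 := nonreg_null hont r₀ N' (fun r hr => hr)
  have hsub : {y : E2 | y 0 ∈ Icc (-((1 - ε) * t / (l₂ * s))) (-(ε * t / (l₂ * s))) ∧
      y 1 ∈ Icc (a + 2 * ε) (b - 2 * ε)} ⊆
      Qp r₀ j e₃ '' (good C r₀ e₁ e₂ l₁ l₂ ε t) ∪ Qp r₀ j e₃ '' N' := by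
    rintro y ⟨hy0, hy1⟩
    obtain ⟨r, hr, hrt, hrβ, hrx, hrn⟩ := h t ht htτ (s * y 0) (y 1) (by
        have := mul_le_mul_of_nonneg_left hy0.1 hs.le
        refine le_trans (le_of_eq ?_) this
        field_simp) (by
        have := mul_le_mul_of_nonneg_left hy0.2 hs.le
        refine le_trans this (le_of_eq ?_)
        field_simp) hy1.1 hy1.2
    have hQ : Qp r₀ j e₃ r = y := by
      ext i
      fin_cases i
      · simp only [Fin.zero_eta, Qp_zero, hj, inner_smul_right, inner_sub_right, hrβ]
        field_simp
      · simp only [Fin.mk_one, Qp_one, hrx]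
    rw [← image_union]
    refine ⟨r, ?_, hQ⟩
    have hrC : r ∈ C := H.closedC.frontier_subset hr
    obtain ⟨n, hn⟩ := exists_normal H.body hr
    by_cases hreg : IsRegularPt C r
    · left
      exact ⟨hr, hrt, hreg, hrn _ (normalMap_spec ⟨n, hn⟩)⟩
    · right
      refine ⟨hrC, ?_⟩
      by_contra hcon
      apply hreg
      refine ⟨n, hn, fun n' hn' => ?_⟩
      by_contra hne
      refine hcon ⟨n', n, hne, hn', hn, ?_, ?_⟩
      · have := H.inner_ge_half (hrn _ hn'); linarith
      · have := H.inner_ge_half (hrn _ hn); linarith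
  have e1 : (1 - 2 * ε) * t / (l₂ * s) =
      -(ε * t / (l₂ * s)) - -((1 - ε) * t / (l₂ * s)) := by ring
  have e2 : b - a - 4 * ε = (b - 2 * ε) - (a + 2 * ε) := by ring
  rw [e1, e2, ← kap_rect _ _ _ _ (by
    have : ε * t / (l₂ * s) = ε * (t / (l₂ * s)) := by ring
    have : (1 - ε) * t / (l₂ * s) = (1 - ε) * (t / (l₂ * s)) := by ring
    nlinarith) (by linarith)]
  calc _ ≤ _ := measure_mono hsub
    _ ≤ _ := measure_union_le _ _
    _ = μH[2] (Qp r₀ j e₃ '' (good C r₀ e₁ e₂ l₁ l₂ ε t)) := by rw [hnull, add_zero]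
    _ ≤ _ := Qp_measure_le hont r₀ _

end Setup

namespace Setup
variable {C : Set E3} {r₀ e₁ e₂ e₃ f₁ f₂ : E3} {c s a b : ℝ}

lemma slope_of_near (H : Setup C r₀ e₁ e₂ e₃ f₁ f₂ c s a b) {r n : E3} {ε : ℝ}
    (hε1 : ε < 1 / 2) (hr : r ∈ C) (hn : IsOutwardNormalAt C r n) (h : ‖n - e₁‖ ≤ ε) :
    SlopeN C e₁ ((1 / s) • (e₂ - c • e₁)) e₃ (2 * ε) r := by
  have h1 := H.inner_ge_half h
  have hε0 : 0 ≤ ε := (norm_nonneg _).trans h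
  refine ⟨hr, n, hn, by linarith, ?_⟩
  have h2 := H.fr.ont1 (n - e₁)
  have z1 : ⟪e₁, (1 / s) • (e₂ - c • e₁)⟫ = 0 := by
    rw [inner_smul_right, inner_sub_right, inner_smul_right, H.fr.h11, H.fr.h12]; ring
  rw [inner_sub_left n e₁ ((1 / s) • (e₂ - c • e₁)), inner_sub_left n e₁ e₃, z1, H.fr.h13,
    sub_zero, sub_zero] at h2
  have h3 : ‖n - e₁‖ ^ 2 ≤ ε ^ 2 := by gcongr
  have h4 : ε ^ 2 ≤ (2 * ε * ⟪n, e₁⟫) ^ 2 := by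
    apply pow_le_pow_left₀ hε0
    nlinarith
  have := sq_nonneg ⟪n - e₁, e₁⟫
  linarith

lemma face_upper (H : Setup C r₀ e₁ e₂ e₃ f₁ f₂ c s a b) {l₁ l₂ ε : ℝ} (hl₁ : 0 < l₁)
    (hl₂ : 0 < l₂) (hε : 0 < ε) (hε1 : ε < 1 / 2) :
    ∃ η₀ > 0, ∀ η, 0 < η → η ≤ η₀ → ∃ τ > 0, ∀ t, 0 < t → t ≤ τ →
      μH[2] {r | r ∈ frontier C ∧ -t ≤ l₁ * ⟪r - r₀, e₁⟫ + l₂ * ⟪r - r₀, e₂⟫ ∧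
        ⟪r - r₀, e₃⟫ ∈ Icc (a + 2 * ε) (b - 2 * ε) ∧ η * ⟪r - r₀, e₂⟫ ≤ ⟪r - r₀, e₁⟫ ∧
        ⟪r - r₀, e₂⟫ < 0} ≤
      ENNReal.ofReal ((1 + 2 * ε) ^ 2 * (kap * (((1 + 2 * ε) * t / (l₂ * s)) * (b - a)))) := by
  obtain ⟨η₀, hη₀, hN⟩ := H.normals hε
  refine ⟨min η₀ ε, by positivity, fun η h0 hη => ?_⟩
  obtain ⟨τ, hτ, hno⟩ := hN η h0 (hη.trans (min_le_left _ _)) ε hε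
  have hηε : η ≤ ε := hη.trans (min_le_right _ _)
  have hs := H.fr.hs
  refine ⟨τ * l₂, by positivity, fun t ht htτ => ?_⟩
  have hT : 0 < t / (l₂ * s) := by positivity
  have e1 : (1 + 2 * ε) * t / (l₂ * s) =
      (ε * t / (l₂ * s)) - -((1 + ε) * t / (l₂ * s)) := by ring
  have htl : t / l₂ ≤ τ := by rwa [div_le_iff₀ hl₂]
  have hb : ∀ r, r ∈ frontier C → -t ≤ l₁ * ⟪r - r₀, e₁⟫ + l₂ * ⟪r - r₀, e₂⟫ →
      -(t / l₂) ≤ ⟪r - r₀, e₂⟫ := by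
    intro r hr h1
    have h2 := H.neg1 r (H.closedC.frontier_subset hr)
    have h3 : l₁ * ⟪r - r₀, e₁⟫ ≤ 0 := mul_nonpos_of_nonneg_of_nonpos hl₁.le h2
    rw [neg_le, div_eq_mul_inv, ← div_eq_mul_inv, le_div_iff₀ hl₂]
    linarith
  rw [e1]
  refine slope_rect (C := C) H.fr.ont1 r₀ _ (2 * ε) (by positivity) ?_ ?_ H.hab.le ?_ ?_
  · rintro r ⟨hr, h1, h2, h3, h4⟩
    obtain ⟨n, hn⟩ := exists_normal H.body hr
    have hrC := H.closedC.frontier_subset hr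
    have := hb r hr h1
    exact H.slope_of_near hε1 hrC hn (hno r hrC h2 h3 (by linarith) h4 n hn)
  · have : ε * t / (l₂ * s) = ε * (t / (l₂ * s)) := by ring
    have : (1 + ε) * t / (l₂ * s) = (1 + ε) * (t / (l₂ * s)) := by ring
    nlinarith
  · rintro r ⟨hr, h1, h2, h3, h4⟩
    have h5 := hb r hr h1
    have hα := H.neg1 r (H.closedC.frontier_subset hr)
    rw [inner_smul_right, inner_sub_right, inner_smul_right]
    set α := ⟪r - r₀, e₁⟫
    set β := ⟪r - r₀, e₂⟫
    have hcα : |c * α| ≤ - α := by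
      rw [abs_mul, abs_of_nonpos hα]
      exact mul_le_of_le_one_left (by linarith) H.fr.c_le
    have hcα' := abs_le.1 hcα
    have h6 : ε * β ≤ η * β := mul_le_mul_of_nonpos_right hηε h4.le
    have h7 : ε * (-(t / l₂)) ≤ ε * β := mul_le_mul_of_nonneg_left h5 hε.le
    have e2 : -((1 + ε) * t / (l₂ * s)) = 1 / s * (-(t / l₂) - ε * (t / l₂)) := by
      field_simp; ring
    have e3 : ε * t / (l₂ * s) = 1 / s * (ε * (t / l₂)) := by
      field_simp
    rw [e2, e3]
    have hs' : 0 ≤ 1 / s := by positivity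
    constructor <;> apply mul_le_mul_of_nonneg_left _ hs' <;> linarith
  · rintro r ⟨hr, h1, h2, h3, h4⟩
    exact ⟨by linarith [h2.1], by linarith [h2.2]⟩

lemma end_upper (H : Setup C r₀ e₁ e₂ e₃ f₁ f₂ c s a b) {l₁ l₂ ε u t : ℝ} (hl₁ : 0 < l₁)
    (hl₂ : 0 < l₂) (hε : 0 < ε) (ht : 0 < t) (htε : t ≤ ε) :
    μH[2] {r | r ∈ frontier C ∧ -t ≤ l₁ * ⟪r - r₀, e₁⟫ + l₂ * ⟪r - r₀, e₂⟫ ∧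
        ⟪r - r₀, e₃⟫ ∈ Icc u (u + 3 * ε)} ≤
      ENNReal.ofReal (18 * kap * (6 * (1 / l₁ + 1 / l₂) / s + 3 / l₁ +
        2 * (1 / l₁ + 1 / l₂) / (s * l₁)) * ε * t) := by
  have hs := H.fr.hs
  set K := 1 / l₁ + 1 / l₂ with hK
  have hK0 : 0 < K := by positivity
  have hb : ∀ r, r ∈ frontier C → -t ≤ l₁ * ⟪r - r₀, e₁⟫ + l₂ * ⟪r - r₀, e₂⟫ →
      -(t / l₂) ≤ ⟪r - r₀, e₂⟫ ∧ -(t / l₁) ≤ ⟪r - r₀, e₁⟫ := by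
    intro r hr h1
    have h2 := H.neg1 r (H.closedC.frontier_subset hr)
    have h2' := H.neg2 r (H.closedC.frontier_subset hr)
    have h3 : l₁ * ⟪r - r₀, e₁⟫ ≤ 0 := mul_nonpos_of_nonneg_of_nonpos hl₁.le h2
    have h3' : l₂ * ⟪r - r₀, e₂⟫ ≤ 0 := mul_nonpos_of_nonneg_of_nonpos hl₂.le h2'
    constructor
    · rw [neg_le, le_div_iff₀ hl₂]; linarith
    · rw [neg_le, le_div_iff₀ hl₁]; linarith
  refine (crude_box H.body H.fr.ont1 r₀ _ (fun r hr => hr.1) (p := -(K * t / s)) (q := K * t / s)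
    (u := u) (v := u + 3 * ε) (z := -(t / l₁)) (w := 0) ?_ (by linarith) ?_ ?_ ?_
    (fun r hr => hr.2.2)).trans ?_
  · have : 0 < K * t / s := by positivity
    linarith
  · have : 0 < t / l₁ := by positivity
    linarith
  · rintro r ⟨hr, h1, -⟩
    exact ⟨(hb r hr h1).2, H.neg1 r (H.closedC.frontier_subset hr)⟩
  · rintro r ⟨hr, h1, -⟩
    obtain ⟨g1, g2⟩ := hb r hr h1
    have hα := H.neg1 r (H.closedC.frontier_subset hr)
    have hβ := H.neg2 r (H.closedC.frontier_subset hr)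
    rw [inner_smul_right, inner_sub_right, inner_smul_right]
    set α := ⟪r - r₀, e₁⟫
    set β := ⟪r - r₀, e₂⟫
    have hcα : |c * α| ≤ - α := by
      rw [abs_mul, abs_of_nonpos hα]
      exact mul_le_of_le_one_left (by linarith) H.fr.c_le
    have hcα' := abs_le.1 hcα
    have e2 : K * t / s = 1 / s * (t / l₁ + t / l₂) := by
      rw [hK]; ring
    rw [e2, ← mul_neg]
    have hs' : 0 ≤ 1 / s := by positivity
    constructor <;> apply mul_le_mul_of_nonneg_left _ hs' <;> linarith
  · apply ENNReal.ofReal_le_ofReal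
    have hk := kap_pos
    have h1 : t * (2 * K / (s * l₁) * t) ≤ ε * (2 * K / (s * l₁) * t) := by gcongr
    have e : (K * t / s - -(K * t / s)) * (u + 3 * ε - u) + (u + 3 * ε - u) * (0 - -(t / l₁)) +
        (0 - -(t / l₁)) * (K * t / s - -(K * t / s)) =
        (6 * K / s + 3 / l₁) * ε * t + t * (2 * K / (s * l₁) * t) := by
      field_simp; ring
    rw [e]
    have : 18 * kap * (6 * K / s + 3 / l₁ + 2 * K / (s * l₁)) * ε * t =
      18 * kap * ((6 * K / s + 3 / l₁) * ε * t + ε * (2 * K / (s * l₁) * t)) := by ring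
    rw [this]
    gcongr

lemma total_upper (H : Setup C r₀ e₁ e₂ e₃ f₁ f₂ c s a b) {l₁ l₂ : ℝ} (hl₁ : 0 < l₁)
    (hl₂ : 0 < l₂) : ∃ K : ℝ, 0 ≤ K ∧ ∀ ε, 0 < ε → ε < 1 / 2 → ∃ τ > 0, ∀ t, 0 < t → t ≤ τ →
      μH[2] {r | r ∈ frontier C ∧ -t ≤ l₁ * ⟪r - r₀, e₁⟫ + l₂ * ⟪r - r₀, e₂⟫} ≤
      ENNReal.ofReal (((1 + 2 * ε) ^ 3 * (kap * (b - a) / (l₂ * s) + kap * (b - a) / (l₁ * s)) +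
        K * ε) * t) := by
  have hs := H.fr.hs
  have hk := kap_pos
  set K := 18 * kap * (6 * (1 / l₁ + 1 / l₂) / s + 3 / l₁ +
        2 * (1 / l₁ + 1 / l₂) / (s * l₁)) with hK
  have hK0 : 0 ≤ K := by positivity
  refine ⟨2 * K, by positivity, fun ε hε hε1 => ?_⟩
  obtain ⟨η₁, hη₁, F1⟩ := H.face_upper hl₁ hl₂ hε hε1
  obtain ⟨η₂, hη₂, F2⟩ := H.swap.face_upper hl₂ hl₁ hε hε1
  obtain ⟨η, h0, hh1, hh2, hh3⟩ : ∃ η, 0 < η ∧ η ≤ η₁ ∧ η ≤ η₂ ∧ η < 1 :=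
    ⟨min (min η₁ η₂) (1 / 2), by positivity, (min_le_left _ _).trans (min_le_left _ _),
      (min_le_left _ _).trans (min_le_right _ _),
      lt_of_le_of_lt (min_le_right _ _) (by norm_num)⟩
  obtain ⟨τ₁, hτ₁, G1⟩ := F1 η h0 hh1
  obtain ⟨τ₂, hτ₂, G2⟩ := F2 η h0 hh2
  obtain ⟨τ₃, hτ₃, D⟩ := H.dichotomy hε h0 hh3
  obtain ⟨τ₄, hτ₄, O⟩ := H.out ε hε
  refine ⟨min (min (min τ₁ τ₂) (min (τ₃ * l₁) (τ₃ * l₂))) (min (min (τ₄ * l₁) (τ₄ * l₂)) ε),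
    by positivity, fun t ht htτ => ?_⟩
  simp only [le_min_iff] at htτ
  obtain ⟨⟨⟨t1, t2⟩, t3, t3'⟩, ⟨t4, t4'⟩, t5⟩ := htτ
  rw [← div_le_iff₀ hl₁] at t3 t4
  rw [← div_le_iff₀ hl₂] at t3' t4'
  have E1 := H.end_upper (u := a - ε) hl₁ hl₂ hε ht t5
  have E2 := H.end_upper (u := b - 2 * ε) hl₁ hl₂ hε ht t5
  rw [← hK] at E1 E2
  have G1' := G1 t ht t1
  have G2' := G2 t ht t2
  have E3 : μH[2] {r | r ∈ frontier C ∧ ⟪r - r₀, e₁⟫ = 0 ∧ ⟪r - r₀, e₂⟫ = 0 ∧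
      ⟪r - r₀, e₃⟫ ∈ Icc (a - ε) (b + ε)} ≤ 0 := by
    refine (crude_box H.body H.fr.ont1 r₀ _ (fun r hr => hr.1) (p := 0) (q := 0)
      (u := a - ε) (v := b + ε) (z := 0) (w := 0) le_rfl (by linarith [H.hab]) le_rfl ?_ ?_
      (fun r hr => hr.2.2.2)).trans ?_
    · rintro r ⟨hr, h1, h2, h3⟩
      rw [h1]; simp
    · rintro r ⟨hr, h1, h2, h3⟩
      rw [inner_smul_right, inner_sub_right, inner_smul_right, h1, h2]; simp
    · simp
  set S1 := {r | r ∈ frontier C ∧ -t ≤ l₁ * ⟪r - r₀, e₁⟫ + l₂ * ⟪r - r₀, e₂⟫ ∧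
        ⟪r - r₀, e₃⟫ ∈ Icc (a + 2 * ε) (b - 2 * ε) ∧ η * ⟪r - r₀, e₂⟫ ≤ ⟪r - r₀, e₁⟫ ∧
        ⟪r - r₀, e₂⟫ < 0} with hS1
  set S2 := {r | r ∈ frontier C ∧ -t ≤ l₂ * ⟪r - r₀, e₂⟫ + l₁ * ⟪r - r₀, e₁⟫ ∧
        ⟪r - r₀, e₃⟫ ∈ Icc (a + 2 * ε) (b - 2 * ε) ∧ η * ⟪r - r₀, e₁⟫ ≤ ⟪r - r₀, e₂⟫ ∧
        ⟪r - r₀, e₁⟫ < 0} with hS2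
  set S3 := {r | r ∈ frontier C ∧ -t ≤ l₁ * ⟪r - r₀, e₁⟫ + l₂ * ⟪r - r₀, e₂⟫ ∧
        ⟪r - r₀, e₃⟫ ∈ Icc (a - ε) (a - ε + 3 * ε)} with hS3
  set S4 := {r | r ∈ frontier C ∧ -t ≤ l₁ * ⟪r - r₀, e₁⟫ + l₂ * ⟪r - r₀, e₂⟫ ∧
        ⟪r - r₀, e₃⟫ ∈ Icc (b - 2 * ε) (b - 2 * ε + 3 * ε)} with hS4
  set S5 := {r | r ∈ frontier C ∧ ⟪r - r₀, e₁⟫ = 0 ∧ ⟪r - r₀, e₂⟫ = 0 ∧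
      ⟪r - r₀, e₃⟫ ∈ Icc (a - ε) (b + ε)} with hS5
  have hsub : {r | r ∈ frontier C ∧ -t ≤ l₁ * ⟪r - r₀, e₁⟫ + l₂ * ⟪r - r₀, e₂⟫} ⊆
      S1 ∪ (S2 ∪ (S3 ∪ (S4 ∪ S5))) := by
    rintro r ⟨hr, h1⟩
    have hα := H.neg1 r (H.closedC.frontier_subset hr)
    have hβ := H.neg2 r (H.closedC.frontier_subset hr)
    have h3 : l₁ * ⟪r - r₀, e₁⟫ ≤ 0 := mul_nonpos_of_nonneg_of_nonpos hl₁.le hα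
    have h3' : l₂ * ⟪r - r₀, e₂⟫ ≤ 0 := mul_nonpos_of_nonneg_of_nonpos hl₂.le hβ
    have b2 : -(t / l₂) ≤ ⟪r - r₀, e₂⟫ := by
      rw [neg_le, le_div_iff₀ hl₂]; linarith
    have b1 : -(t / l₁) ≤ ⟪r - r₀, e₁⟫ := by
      rw [neg_le, le_div_iff₀ hl₁]; linarith
    have hx := O r (H.closedC.frontier_subset hr) (by linarith) (by linarith)
    by_cases c1 : ⟪r - r₀, e₃⟫ ≤ a + 2 * ε
    · right; right; left
      exact ⟨hr, h1, hx.1, by linarith⟩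
    by_cases c2 : b - 2 * ε ≤ ⟪r - r₀, e₃⟫
    · right; right; right; left
      exact ⟨hr, h1, c2, by linarith [hx.2]⟩
    push Not at c1 c2
    have hx' : ⟪r - r₀, e₃⟫ ∈ Icc (a + 2 * ε) (b - 2 * ε) := ⟨c1.le, c2.le⟩
    rcases D r hr (by linarith) (by linarith) hx' with d | d
    · rcases hβ.lt_or_eq with hlt | heq
      · left
        exact ⟨hr, h1, hx', d, hlt⟩
      · right; right; right; right
        rw [heq, mul_zero] at d
        exact ⟨hr, le_antisymm hα d, heq, hx⟩
    · rcases hα.lt_or_eq with hlt | heq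
      · right; left
        exact ⟨hr, by linarith, hx', d, hlt⟩
      · right; right; right; right
        rw [heq, mul_zero] at d
        exact ⟨hr, heq, le_antisymm hβ d, hx⟩
  have hba : 0 < b - a := by linarith [H.hab]
  calc _ ≤ μH[2] (S1 ∪ (S2 ∪ (S3 ∪ (S4 ∪ S5)))) := measure_mono hsub
    _ ≤ μH[2] S1 + (μH[2] S2 + (μH[2] S3 + (μH[2] S4 + μH[2] S5))) := by
      refine (measure_union_le _ _).trans ?_
      gcongr
      refine (measure_union_le _ _).trans ?_
      gcongr
      refine (measure_union_le _ _).trans ?_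
      gcongr
      exact measure_union_le _ _
    _ ≤ _ := add_le_add G1' (add_le_add G2' (add_le_add E1 (add_le_add E2 E3)))
    _ = _ := by
      rw [add_zero, ← ENNReal.ofReal_add (by positivity) (by positivity),
        ← ENNReal.ofReal_add (by positivity) (by positivity),
        ← ENNReal.ofReal_add (by positivity) (by positivity)]
      congr 1
      field_simp
      ring

end Setup

lemma squeeze_aux (g : ℝ → ℝ≥0∞) (lo up : ℝ → ℝ) (L : ℝ) (hL : 0 < L)
    (hlo : Tendsto lo (𝓝[>] 0) (𝓝 L)) (hup : Tendsto up (𝓝[>] 0) (𝓝 L))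
    (h1 : ∀ᶠ ε in 𝓝[>] (0 : ℝ), ∃ τ > 0, ∀ t, 0 < t → t ≤ τ → ENNReal.ofReal (lo ε * t) ≤ g t)
    (h2 : ∀ᶠ ε in 𝓝[>] (0 : ℝ), ∃ τ > 0, ∀ t, 0 < t → t ≤ τ → g t ≤ ENNReal.ofReal (up ε * t)) :
    Tendsto (fun t => (g t).toReal / t) (𝓝[>] 0) (𝓝 L) := by
  have hfin : ∀ᶠ t in 𝓝[>] (0 : ℝ), g t ≠ ⊤ := by
    obtain ⟨ε, τ, hτ, h⟩ := h2.exists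
    filter_upwards [Ioc_mem_nhdsGT hτ] with t ht
    exact ((h t ht.1 ht.2).trans_lt ENNReal.ofReal_lt_top).ne
  rw [tendsto_order]
  constructor
  · intro a ha
    obtain ⟨ε, hε, hpos, τ, hτ, h⟩ :=
      ((hlo.eventually_const_lt ha).and ((hlo.eventually_const_lt hL).and h1)).exists
    filter_upwards [Ioc_mem_nhdsGT hτ, hfin] with t ht hf
    have := ENNReal.toReal_mono hf (h t ht.1 ht.2)
    rw [ENNReal.toReal_ofReal (mul_nonneg hpos.le ht.1.le)] at this
    exact lt_of_lt_of_le hε ((le_div_iff₀ ht.1).2 this)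
  · intro a ha
    obtain ⟨ε, hε, hpos, τ, hτ, h⟩ :=
      ((hup.eventually_lt_const ha).and ((hup.eventually_const_lt hL).and h2)).exists
    filter_upwards [Ioc_mem_nhdsGT hτ, hfin] with t ht hf
    have := ENNReal.toReal_mono ENNReal.ofReal_ne_top (h t ht.1 ht.2)
    rw [ENNReal.toReal_ofReal (mul_nonneg hpos.le ht.1.le)] at this
    exact lt_of_le_of_lt ((div_le_iff₀ ht.1).2 this) hε

namespace Setup
variable {C : Set E3} {r₀ e₁ e₂ e₃ f₁ f₂ : E3} {c s a b : ℝ}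

lemma inner_j (H : Setup C r₀ e₁ e₂ e₃ f₁ f₂ c s a b) {l₁ l₂ t : ℝ} (hl₂ : 0 < l₂)
    (hl : l₁ ^ 2 + l₂ ^ 2 + 2 * c * l₁ * l₂ = 1) (v : E3)
    (hv : l₁ * ⟪v, e₁⟫ + l₂ * ⟪v, e₂⟫ = -t) :
    ⟪v, (1 / s) • ((l₁ + c * l₂) • e₂ - (l₁ * c + l₂) • e₁)⟫ =
      -((l₁ + c * l₂) * t / (l₂ * s)) - ⟪v, e₁⟫ / (l₂ * s) := by
  have hs := H.fr.hs
  simp only [inner_smul_right, inner_sub_right]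
  field_simp
  linear_combination (l₁ + c * l₂) * hv - ⟪v, e₁⟫ * hl

lemma B_upper (H : Setup C r₀ e₁ e₂ e₃ f₁ f₂ c s a b) {l₁ l₂ ε : ℝ} (hl₁ : 0 < l₁)
    (hl₂ : 0 < l₂) (hl : l₁ ^ 2 + l₂ ^ 2 + 2 * c * l₁ * l₂ = 1) (hε : 0 < ε) :
    ∃ τ > 0, ∀ t, 0 < t → t ≤ τ →
      μH[2] {r | r ∈ C ∧ l₁ * ⟪r - r₀, e₁⟫ + l₂ * ⟪r - r₀, e₂⟫ = -t} ≤
      ENNReal.ofReal (kap * ((b - a + 2 * ε) / (l₁ * l₂ * s)) * t) := by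
  have hs := H.fr.hs
  obtain ⟨τ, hτ, O⟩ := H.out ε hε
  refine ⟨min (τ * l₁) (τ * l₂), by positivity, fun t ht htτ => ?_⟩
  simp only [le_min_iff] at htτ
  obtain ⟨t4, t4'⟩ := htτ
  rw [← div_le_iff₀ hl₁] at t4
  rw [← div_le_iff₀ hl₂] at t4'
  have hT : 0 < t / (l₁ * l₂ * s) := by positivity
  set A := -((l₁ + c * l₂) * t / (l₂ * s)) with hA
  have e1 : kap * ((b - a + 2 * ε) / (l₁ * l₂ * s)) * t =
      kap * (((A + t / (l₁ * l₂ * s)) - A) * ((b + ε) - (a - ε))) := by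
    ring
  have hg := graph_upper (H.fr.ont l₁ l₂ hl) r₀
    {r | r ∈ C ∧ l₁ * ⟪r - r₀, e₁⟫ + l₂ * ⟪r - r₀, e₂⟫ = -t} 0 le_rfl (by
      rintro r ⟨hr, h1⟩ r' ⟨hr', h1'⟩
      have e : r - r' = (r - r₀) - (r' - r₀) := by abel
      rw [e, inner_sub_left, inner_add_right, inner_add_right, inner_smul_right, inner_smul_right,
        inner_smul_right, inner_smul_right, h1, h1']
      simp)
  refine hg.trans ?_
  rw [e1, ← kap_rect _ _ _ _ (by linarith) (by linarith [H.hab])]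
  simp only [add_zero, one_pow, ENNReal.ofReal_one, one_mul]
  apply measure_mono
  rintro _ ⟨r, ⟨hr, h1⟩, rfl⟩
  have hα := H.neg1 r hr
  have hβ := H.neg2 r hr
  have h3 : l₁ * ⟪r - r₀, e₁⟫ ≤ 0 := mul_nonpos_of_nonneg_of_nonpos hl₁.le hα
  have h3' : l₂ * ⟪r - r₀, e₂⟫ ≤ 0 := mul_nonpos_of_nonneg_of_nonpos hl₂.le hβ
  have b2 : -(t / l₂) ≤ ⟪r - r₀, e₂⟫ := by
    rw [neg_le, le_div_iff₀ hl₂]; linarith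
  have b1 : -(t / l₁) ≤ ⟪r - r₀, e₁⟫ := by
    rw [neg_le, le_div_iff₀ hl₁]; linarith
  have hx := O r hr (by linarith) (by linarith)
  refine ⟨?_, by rw [Qp_one]; exact hx⟩
  rw [Qp_zero, H.inner_j hl₂ hl _ h1, ← hA]
  have h5 : ⟪r - r₀, e₁⟫ / (l₂ * s) ≤ 0 := div_nonpos_of_nonpos_of_nonneg hα (by positivity)
  have h6 : -(t / l₁) / (l₂ * s) ≤ ⟪r - r₀, e₁⟫ / (l₂ * s) := by gcongr
  have h7 : -(t / l₁) / (l₂ * s) = -(t / (l₁ * l₂ * s)) := by field_simp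
  constructor <;> linarith

lemma B_lower (H : Setup C r₀ e₁ e₂ e₃ f₁ f₂ c s a b) {l₁ l₂ ε : ℝ} (hl₁ : 0 < l₁)
    (hl₂ : 0 < l₂) (hl : l₁ ^ 2 + l₂ ^ 2 + 2 * c * l₁ * l₂ = 1) (hε : 0 < ε) (hε1 : ε < 1 / 2)
    (hε2 : 4 * ε < b - a) :
    ∃ τ > 0, ∀ t, 0 < t → t ≤ τ →
      ENNReal.ofReal (kap * ((1 - 2 * ε) * (b - a - 2 * ε) / (l₁ * l₂ * s)) * t) ≤
      μH[2] {r | r ∈ C ∧ l₁ * ⟪r - r₀, e₁⟫ + l₂ * ⟪r - r₀, e₂⟫ = -t} := by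
  have hs := H.fr.hs
  obtain ⟨η, h0, hη1, hη2, hη3⟩ : ∃ η, 0 < η ∧ η < 1 ∧ η / l₂ ≤ ε / l₁ ∧ η / l₁ ≤ ε / l₂ := by
    refine ⟨min (1 / 2) (min (ε / l₁ * l₂) (ε / l₂ * l₁)), by positivity,
      lt_of_le_of_lt (min_le_left _ _) (by norm_num), ?_, ?_⟩
    · rw [div_le_iff₀ hl₂]; exact (min_le_right _ _).trans (min_le_left _ _)
    · rw [div_le_iff₀ hl₁]; exact (min_le_right _ _).trans (min_le_right _ _)
  obtain ⟨τ, hτ, O⟩ := H.inn ε hε η h0 hη1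
  refine ⟨min (τ * l₁) (τ * l₂), by positivity, fun t ht htτ => ?_⟩
  simp only [le_min_iff] at htτ
  obtain ⟨t4, t4'⟩ := htτ
  rw [← div_le_iff₀ hl₁] at t4
  rw [← div_le_iff₀ hl₂] at t4'
  have hT : 0 < t / (l₁ * l₂ * s) := by positivity
  set A := -((l₁ + c * l₂) * t / (l₂ * s)) with hA
  have e1 : kap * ((1 - 2 * ε) * (b - a - 2 * ε) / (l₁ * l₂ * s)) * t =
      kap * (((A + (1 - ε) * (t / (l₁ * l₂ * s))) - (A + ε * (t / (l₁ * l₂ * s)))) *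
        ((b - ε) - (a + ε))) := by
    ring
  rw [e1, ← kap_rect _ _ _ _ (by nlinarith) (by linarith)]
  refine le_trans (measure_mono ?_) (Qp_measure_le (H.fr.ont l₁ l₂ hl) r₀ _)
  rintro y ⟨hy0, hy1⟩
  set u := (y 0 - A) * (l₁ * l₂ * s) / t with hu
  have hu0 : u * (t / (l₁ * l₂ * s)) = y 0 - A := by rw [hu]; field_simp
  have hu1 : ε ≤ u := by
    refine le_of_mul_le_mul_right (?_ : ε * (t / (l₁ * l₂ * s)) ≤ _) hT
    rw [hu0]; linarith [hy0.1]
  have hu2 : u ≤ 1 - ε := by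
    refine le_of_mul_le_mul_right (?_ : _ ≤ (1 - ε) * (t / (l₁ * l₂ * s))) hT
    rw [hu0]; linarith [hy0.2]
  have tl1 : 0 < t / l₁ := by positivity
  have tl2 : 0 < t / l₂ := by positivity
  have k1 : η * (t / l₂) ≤ ε * (t / l₁) := by
    have := mul_le_mul_of_nonneg_left hη2 ht.le
    calc η * (t / l₂) = t * (η / l₂) := by ring
      _ ≤ _ := this
      _ = _ := by ring
  have k2 : η * (t / l₁) ≤ ε * (t / l₂) := by
    have := mul_le_mul_of_nonneg_left hη3 ht.le
    calc η * (t / l₁) = t * (η / l₁) := by ring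
      _ ≤ _ := this
      _ = _ := by ring
  have m1 : ε * (t / l₁) ≤ u * (t / l₁) := by gcongr
  have m2 : ε * (t / l₂) ≤ (1 - u) * (t / l₂) :=
    mul_le_mul_of_nonneg_right (by linarith) tl2.le
  have m3 : u * (t / l₁) ≤ 1 * (t / l₁) :=
    mul_le_mul_of_nonneg_right (by linarith) tl1.le
  have m4 : (1 - u) * (t / l₂) ≤ 1 * (t / l₂) :=
    mul_le_mul_of_nonneg_right (by linarith) tl2.le
  have m5 : η * (u * (t / l₁)) ≤ η * (1 * (t / l₁)) := mul_le_mul_of_nonneg_left m3 h0.le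
  have m6 : η * ((1 - u) * (t / l₂)) ≤ η * (1 * (t / l₂)) := mul_le_mul_of_nonneg_left m4 h0.le
  have hmem := O (-(u * (t / l₁))) (-((1 - u) * (t / l₂))) (y 1) (by linarith) (by linarith)
    (by linarith) (by linarith) hy1.1 hy1.2
  have hh : l₁ * ⟪pt r₀ f₁ f₂ e₃ (-(u * (t / l₁))) (-((1 - u) * (t / l₂))) (y 1) - r₀, e₁⟫ +
      l₂ * ⟪pt r₀ f₁ f₂ e₃ (-(u * (t / l₁))) (-((1 - u) * (t / l₂))) (y 1) - r₀, e₂⟫ = -t := by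
    rw [pt_e1 H.fr, pt_e2 H.fr]; field_simp; ring
  refine ⟨_, ⟨hmem, hh⟩, ?_⟩
  ext i
  fin_cases i
  · simp only [Fin.zero_eta, Qp_zero]
    rw [H.inner_j hl₂ hl _ hh, ← hA, pt_e1 H.fr]
    have : -(u * (t / l₁)) / (l₂ * s) = -(u * (t / (l₁ * l₂ * s))) := by field_simp
    rw [this, hu0]; ring
  · simp only [Fin.mk_one, Qp_one, pt_e3 H.fr]

lemma small_ev {d : ℝ} (hd : 0 < d) : ∀ᶠ ε in 𝓝[>] (0 : ℝ), 0 < ε ∧ ε < d := by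
  filter_upwards [Ioo_mem_nhdsGT hd] with ε h using h

lemma B_tendsto (H : Setup C r₀ e₁ e₂ e₃ f₁ f₂ c s a b) {l₁ l₂ : ℝ} (hl₁ : 0 < l₁)
    (hl₂ : 0 < l₂) (hl : l₁ ^ 2 + l₂ ^ 2 + 2 * c * l₁ * l₂ = 1) :
    Tendsto (fun t => (μH[2] (Bset C r₀ (l₁ • e₁ + l₂ • e₂) t)).toReal / t) (𝓝[>] 0)
      (𝓝 (kap * (b - a) / (l₁ * l₂ * s))) := by
  have hs := H.fr.hs
  have hk := kap_pos
  have hba : 0 < b - a := by linarith [H.hab]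
  have hset : ∀ t, Bset C r₀ (l₁ • e₁ + l₂ • e₂) t =
      {r | r ∈ C ∧ l₁ * ⟪r - r₀, e₁⟫ + l₂ * ⟪r - r₀, e₂⟫ = -t} := by
    intro t
    ext r
    simp [Bset, inner_add_right, inner_smul_right]
  simp only [hset]
  refine squeeze_aux _ (fun ε => kap * ((1 - 2 * ε) * (b - a - 2 * ε) / (l₁ * l₂ * s)))
    (fun ε => kap * ((b - a + 2 * ε) / (l₁ * l₂ * s))) _ (by positivity) ?_ ?_ ?_ ?_
  · refine tendsto_nhdsWithin_of_tendsto_nhds ?_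
    refine Continuous.tendsto' (by fun_prop) _ _ ?_
    ring
  · refine tendsto_nhdsWithin_of_tendsto_nhds ?_
    refine Continuous.tendsto' (by fun_prop) _ _ ?_
    ring
  · filter_upwards [small_ev (show (0 : ℝ) < 1 / 2 by norm_num),
      small_ev (show 0 < (b - a) / 4 by positivity)] with ε h1 h2
    exact H.B_lower hl₁ hl₂ hl h1.1 h1.2 (by linarith)
  · filter_upwards [small_ev (show (0 : ℝ) < 1 / 2 by norm_num)] with ε h1
    exact H.B_upper hl₁ hl₂ hl h1.1

lemma sset_eq (l₁ l₂ t : ℝ) : Sset C r₀ (l₁ • e₁ + l₂ • e₂) t =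
    {r | r ∈ frontier C ∧ -t ≤ l₁ * ⟪r - r₀, e₁⟫ + l₂ * ⟪r - r₀, e₂⟫} := by
  ext r
  simp [Sset, inner_add_right, inner_smul_right]

lemma sset_compact (H : Setup C r₀ e₁ e₂ e₃ f₁ f₂ c s a b) (e : E3) (t : ℝ) :
    IsCompact (Sset C r₀ e t) := by
  refine (H.body.1.of_isClosed_subset isClosed_frontier H.closedC.frontier_subset).inter_right ?_
  exact isClosed_le continuous_const (by fun_prop)

/-- unnormalized push-forward -/
def MM (C : Set E3) (r₀ e : E3) (t : ℝ) : Measure E3 :=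
  Measure.map (normalMap C) (μH[2].restrict (Sset C r₀ e t ∩ {r : E3 | IsRegularPt C r}))

lemma MM_lower (H : Setup C r₀ e₁ e₂ e₃ f₁ f₂ c s a b) {l₁ l₂ : ℝ} (hl₁ : 0 < l₁)
    (hl₂ : 0 < l₂) : ∀ δ > 0, ∀ᶠ t in 𝓝[>] (0 : ℝ),
      ENNReal.ofReal ((kap * (b - a) / (l₂ * s) - δ) * t) ≤
        MM C r₀ (l₁ • e₁ + l₂ • e₂) t (Metric.ball e₁ δ) := by
  intro δ hδ
  have hs := H.fr.hs
  have hba : 0 < b - a := by linarith [H.hab]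
  have hT : Tendsto (fun ε => kap * (((1 - 2 * ε) / (l₂ * s)) * (b - a - 4 * ε))) (𝓝[>] 0)
      (𝓝 (kap * (b - a) / (l₂ * s))) := by
    refine tendsto_nhdsWithin_of_tendsto_nhds ?_
    refine Continuous.tendsto' (by fun_prop) _ _ ?_
    ring
  obtain ⟨ε, h1, h2, h3, h4⟩ := ((small_ev (show (0 : ℝ) < 1 / 2 by norm_num)).and
    ((small_ev (show 0 < (b - a) / 4 by positivity)).and ((small_ev hδ).and
    (hT.eventually_const_lt (show kap * (b - a) / (l₂ * s) - δ < _ by linarith))))).exists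
  obtain ⟨τ, hτ, h⟩ := H.lower hl₁ hl₂ h1.1 h1.2 (by linarith)
  filter_upwards [Ioc_mem_nhdsGT hτ] with t ht
  calc _ ≤ ENNReal.ofReal (kap * (((1 - 2 * ε) * t / (l₂ * s)) * (b - a - 4 * ε))) := by
        apply ENNReal.ofReal_le_ofReal
        have := mul_le_mul_of_nonneg_right h4.le ht.1.le
        refine this.trans (le_of_eq ?_)
        ring
    _ ≤ _ := h t ht.1 ht.2
    _ ≤ μH[2] (normalMap C ⁻¹' (Metric.ball e₁ δ) ∩
          (Sset C r₀ (l₁ • e₁ + l₂ • e₂) t ∩ {r : E3 | IsRegularPt C r})) := by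
        apply measure_mono
        rintro r ⟨g1, g2, g3, g4⟩
        refine ⟨?_, ?_, g3⟩
        · rw [mem_preimage, mem_ball_iff_norm]; linarith
        · rw [sset_eq]; exact ⟨g1, g2⟩
    _ ≤ _ := Measure.le_restrict_apply _ _
    _ ≤ _ := Measure.le_map_apply (aemeasurable_normalMap H.body (H.sset_compact _ t)
        inter_subset_left _) _

lemma MM_upper (H : Setup C r₀ e₁ e₂ e₃ f₁ f₂ c s a b) {l₁ l₂ : ℝ} (hl₁ : 0 < l₁)
    (hl₂ : 0 < l₂) : ∀ δ > 0, ∀ᶠ t in 𝓝[>] (0 : ℝ),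
      MM C r₀ (l₁ • e₁ + l₂ • e₂) t univ ≤ ENNReal.ofReal
        ((kap * (b - a) / (l₂ * s) + kap * (b - a) / (l₁ * s) + δ) * t) := by
  intro δ hδ
  have hs := H.fr.hs
  obtain ⟨K, hK, hU⟩ := H.total_upper hl₁ hl₂
  have hT : Tendsto (fun ε => (1 + 2 * ε) ^ 3 *
      (kap * (b - a) / (l₂ * s) + kap * (b - a) / (l₁ * s)) + K * ε) (𝓝[>] 0)
      (𝓝 (kap * (b - a) / (l₂ * s) + kap * (b - a) / (l₁ * s))) := by
    refine tendsto_nhdsWithin_of_tendsto_nhds ?_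
    refine Continuous.tendsto' (by fun_prop) _ _ ?_
    ring
  obtain ⟨ε, h1, h4⟩ := ((small_ev (show (0 : ℝ) < 1 / 2 by norm_num)).and
    (hT.eventually_lt_const (show _ < kap * (b - a) / (l₂ * s) + kap * (b - a) / (l₁ * s) + δ
      by linarith))).exists
  obtain ⟨τ, hτ, h⟩ := hU ε h1.1 h1.2
  filter_upwards [Ioc_mem_nhdsGT hτ] with t ht
  rw [MM, Measure.map_apply_of_aemeasurable (aemeasurable_normalMap H.body (H.sset_compact _ t)
        inter_subset_left _) MeasurableSet.univ, preimage_univ, Measure.restrict_apply_univ]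
  calc _ ≤ μH[2] (Sset C r₀ (l₁ • e₁ + l₂ • e₂) t) := measure_mono inter_subset_left
    _ = μH[2] {r | r ∈ frontier C ∧ -t ≤ l₁ * ⟪r - r₀, e₁⟫ + l₂ * ⟪r - r₀, e₂⟫} := by
      rw [sset_eq]
    _ ≤ _ := h t ht.1 ht.2
    _ ≤ _ := by
      apply ENNReal.ofReal_le_ofReal
      exact mul_le_mul_of_nonneg_right h4.le ht.1.le

lemma main (H : Setup C r₀ e₁ e₂ e₃ f₁ f₂ c s a b) {l₁ l₂ : ℝ} (hl₁ : 0 < l₁)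
    (hl₂ : 0 < l₂) (hl : l₁ ^ 2 + l₂ ^ 2 + 2 * c * l₁ * l₂ = 1) (hne : e₁ ≠ e₂) :
    WeaklyTendsto (nuT C r₀ (l₁ • e₁ + l₂ • e₂))
      (ENNReal.ofReal l₁ • Measure.dirac e₁ + ENNReal.ofReal l₂ • Measure.dirac e₂) := by
  intro f
  have hs := H.fr.hs
  have hk := kap_pos
  have hba : 0 < b - a := by linarith [H.hab]
  have hMA := abstract_tendsto (MM C r₀ (l₁ • e₁ + l₂ • e₂)) e₁ e₂ hne
    (kap * (b - a) / (l₂ * s)) (kap * (b - a) / (l₁ * s)) (H.MM_lower hl₁ hl₂) (by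
      have := H.swap.MM_lower hl₂ hl₁
      rwa [add_comm (l₂ • e₂)] at this) (H.MM_upper hl₁ hl₂) (by positivity) (by positivity) f
  have hB := H.B_tendsto hl₁ hl₂ hl
  have hq := hMA.div hB (by positivity)
  have hlim : ∫ x, f x ∂(ENNReal.ofReal l₁ • Measure.dirac e₁ +
      ENNReal.ofReal l₂ • Measure.dirac e₂) =
      (kap * (b - a) / (l₂ * s) * f e₁ + kap * (b - a) / (l₁ * s) * f e₂) /
        (kap * (b - a) / (l₁ * l₂ * s)) := by
    rw [integral_add_measure, integral_smul_measure, integral_smul_measure, integral_dirac,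
      integral_dirac, ENNReal.toReal_ofReal hl₁.le, ENNReal.toReal_ofReal hl₂.le]
    · simp only [smul_eq_mul]
      field_simp
    · exact (f.integrable _).smul_measure ENNReal.ofReal_ne_top
    · exact (f.integrable _).smul_measure ENNReal.ofReal_ne_top
  rw [hlim]
  refine hq.congr' ?_
  filter_upwards [self_mem_nhdsWithin] with t ht
  have ht' : (0 : ℝ) < t := ht
  change _ = ∫ x, f x ∂((μH[2] (Bset C r₀ (l₁ • e₁ + l₂ • e₂) t))⁻¹ •
    MM C r₀ (l₁ • e₁ + l₂ • e₂) t)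
  rw [integral_smul_measure, ENNReal.toReal_inv, smul_eq_mul]
  simp only [Pi.div_apply]
  rw [div_div_div_cancel_right₀ ht'.ne']
  ring

end Setup

lemma frame_exists (e₁ e₂ : E3) (he₁ : ‖e₁‖ = 1) (he₂ : ‖e₂‖ = 1) (hne : e₁ ≠ e₂)
    (hne' : e₁ ≠ -e₂) : ∃ (e₃ f₁ f₂ : E3) (s : ℝ), Frame e₁ e₂ e₃ f₁ f₂ ⟪e₁, e₂⟫ s := by
  set c := ⟪e₁, e₂⟫ with hc
  have hc1 : c ≠ 1 := fun h => hne ((inner_eq_one_iff_of_norm_eq_one he₁ he₂).1 h)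
  have hc2 : c ≠ -1 := fun h => hne' ((inner_eq_one_iff_of_norm_eq_one (𝕜 := ℝ) he₁
    (by rw [norm_neg, he₂])).1 (by rw [inner_neg_right, ← hc, h, neg_neg]))
  have hc3 : |c| ≤ 1 := by
    have := abs_real_inner_le_norm e₁ e₂
    rwa [he₁, he₂, mul_one] at this
  have hc4 := abs_le.1 hc3
  have hlt1 : c < 1 := lt_of_le_of_ne hc4.2 hc1
  have hlt2 : -1 < c := lt_of_le_of_ne hc4.1 (Ne.symm hc2)
  have hpos : 0 < 1 - c ^ 2 := by nlinarith
  set s := Real.sqrt (1 - c ^ 2) with hs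
  have hs0 : 0 < s := Real.sqrt_pos.2 hpos
  have hsc : s ^ 2 = 1 - c ^ 2 := Real.sq_sqrt hpos.le
  have h11 : ⟪e₁, e₁⟫ = 1 := by rw [real_inner_self_eq_norm_sq, he₁]; norm_num
  have h22 : ⟪e₂, e₂⟫ = 1 := by rw [real_inner_self_eq_norm_sq, he₂]; norm_num
  obtain ⟨w, hw, hw0⟩ : ∃ w : E3, (⟪e₁, w⟫ = 0 ∧ ⟪e₂, w⟫ = 0) ∧ w ≠ 0 := by
    let T : E3 →ₗ[ℝ] ℝ × ℝ := ((innerSL ℝ e₁).toLinearMap).prod ((innerSL ℝ e₂).toLinearMap)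
    have hk : LinearMap.ker T ≠ ⊥ := LinearMap.ker_ne_bot_of_finrank_lt (by simp)
    obtain ⟨w, hw, hw0⟩ := Submodule.exists_mem_ne_zero_of_ne_bot hk
    refine ⟨w, ?_, hw0⟩
    rw [LinearMap.mem_ker] at hw
    exact ⟨congrArg Prod.fst hw, congrArg Prod.snd hw⟩
  have hwn : ‖w‖ ≠ 0 := norm_ne_zero_iff.2 hw0
  set e₃ := ‖w‖⁻¹ • w with he₃
  have h13 : ⟪e₁, e₃⟫ = 0 := by rw [he₃, inner_smul_right, hw.1, mul_zero]
  have h23 : ⟪e₂, e₃⟫ = 0 := by rw [he₃, inner_smul_right, hw.2, mul_zero]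
  have h33 : ⟪e₃, e₃⟫ = 1 := by
    rw [he₃, inner_smul_right, real_inner_smul_left, real_inner_self_eq_norm_sq]
    field_simp
  have h21 : ⟪e₂, e₁⟫ = c := by rw [real_inner_comm]
  have h31 : ⟪e₃, e₁⟫ = 0 := by rw [real_inner_comm, h13]
  have h32 : ⟪e₃, e₂⟫ = 0 := by rw [real_inner_comm, h23]
  let T : E3 →ₗ[ℝ] ℝ × ℝ × ℝ := ((innerSL ℝ e₁).toLinearMap).prod
    (((innerSL ℝ e₂).toLinearMap).prod ((innerSL ℝ e₃).toLinearMap))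
  have hT : ∀ v, T v = (⟪e₁, v⟫, ⟪e₂, v⟫, ⟪e₃, v⟫) := fun v => rfl
  have key : ∀ α β x : ℝ, T (α • ((1 / s ^ 2) • (e₁ - c • e₂)) + β • ((1 / s ^ 2) • (e₂ - c • e₁))
      + x • e₃) = (α, β, x) := by
    intro α β x
    rw [hT]
    have hsc' : 1 - c ^ 2 ≠ 0 := hpos.ne'
    refine Prod.ext ?_ (Prod.ext ?_ ?_) <;>
      simp only [inner_add_right, inner_smul_right, inner_sub_right, h11, h22, h33, ← hc, h21,
        h31, h32, h13, h23, hsc] <;> field_simp <;> ring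
  have hinj : Function.Injective T := by
    rw [LinearMap.injective_iff_surjective_of_finrank_eq_finrank (by simp)]
    rintro ⟨α, β, x⟩
    exact ⟨_, key α β x⟩
  refine ⟨e₃, (1 / s ^ 2) • (e₁ - c • e₂), (1 / s ^ 2) • (e₂ - c • e₁), s,
    ⟨h11, h22, h33, hc.symm, h13, h23, hs0, hsc, rfl, rfl, fun v => hinj ?_⟩⟩
  rw [key, hT, real_inner_comm, real_inner_comm v e₂, real_inner_comm v e₃]

/-- points of `C` approximating the direction `-f₁` -/
lemma approx_pt {C : Set E3} {r₀ e₁ e₂ e₃ f₁ f₂ : E3} {c s : ℝ} (F : Frame e₁ e₂ e₃ f₁ f₂ c s)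
    (hcone : dihedral e₁ e₂ ⊆ tanCone C r₀) {η : ℝ} (hη : 0 < η) :
    ∃ p ∈ C, ⟪p - r₀, e₁⟫ < 0 ∧ η * ⟪p - r₀, e₁⟫ ≤ ⟪p - r₀, e₂⟫ := by
  have hv : -f₁ ∈ tanCone C r₀ := hcone (by
    constructor
    · rw [inner_neg_left, F.f11]; norm_num
    · rw [inner_neg_left, F.f12]; norm_num)
  have hU : IsOpen {w : E3 | ⟪w, e₁⟫ < -(1 / 2) ∧ -(η / 2) < ⟪w, e₂⟫} := by
    have g1 : IsOpen {w : E3 | ⟪w, e₁⟫ < -(1 / 2)} := isOpen_lt (by fun_prop) (by fun_prop)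
    have g2 : IsOpen {w : E3 | -(η / 2) < ⟪w, e₂⟫} := isOpen_lt (by fun_prop) (by fun_prop)
    exact g1.inter g2
  rw [tanCone, mem_closure_iff] at hv
  obtain ⟨w, ⟨hw1, hw2⟩, k, r, hr, hk, rfl⟩ := hv _ hU (by
    constructor
    · rw [inner_neg_left, F.f11]; norm_num
    · rw [inner_neg_left, F.f12]; linarith)
  rw [real_inner_smul_left] at hw1 hw2
  have hk' : 0 < k := by
    rcases hk.lt_or_eq with h | h
    · exact h
    · rw [← h] at hw1; norm_num at hw1
  refine ⟨r, hr, ?_, ?_⟩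
  · by_contra hcon
    push Not at hcon
    have := mul_nonneg hk hcon
    linarith
  · refine le_of_mul_le_mul_left ?_ hk'
    have := mul_lt_mul_of_pos_left hw1 hη
    linarith

lemma inn_aux {C : Set E3} {r₀ e₁ e₂ e₃ f₁ f₂ : E3} {c s a b : ℝ} (F : Frame e₁ e₂ e₃ f₁ f₂ c s)
    (hC : Convex ℝ C) (hcone : tanCone C r₀ = dihedral e₁ e₂)
    (neg1 : ∀ r ∈ C, ⟪r - r₀, e₁⟫ ≤ 0) (neg2 : ∀ r ∈ C, ⟪r - r₀, e₂⟫ ≤ 0)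
    (hin : ∀ x, a ≤ x → x ≤ b → pt r₀ f₁ f₂ e₃ 0 0 x ∈ C) :
    ∀ ε > 0, ∀ η, 0 < η → η < 1 → ∃ τ > 0, ∀ α β x : ℝ, α ≤ η * β → β ≤ η * α → -τ ≤ α →
      -τ ≤ β → a + ε ≤ x → x ≤ b - ε → pt r₀ f₁ f₂ e₃ α β x ∈ C := by
  intro ε hε η h0 h1
  obtain ⟨p₁, hp₁, hα₁, hβ₁⟩ := approx_pt F hcone.symm.subset h0
  obtain ⟨p₂, hp₂, hβ₂, hα₂⟩ := approx_pt (C := C) (r₀ := r₀) F.swap (by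
    rw [hcone]; exact fun v hv => ⟨hv.2, hv.1⟩) h0
  have n1 := neg2 p₁ hp₁
  have n2 := neg1 p₂ hp₂
  have q1 := pt_eq (r₀ := r₀) F p₁
  have q2 := pt_eq (r₀ := r₀) F p₂
  set α₁ := ⟪p₁ - r₀, e₁⟫
  set β₁ := ⟪p₁ - r₀, e₂⟫
  set x₁ := ⟪p₁ - r₀, e₃⟫
  set α₂ := ⟪p₂ - r₀, e₁⟫
  set β₂ := ⟪p₂ - r₀, e₂⟫
  set x₂ := ⟪p₂ - r₀, e₃⟫
  have hpp : 0 < α₁ * β₂ := mul_pos_of_neg_of_neg hα₁ hβ₂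
  set D := α₁ * β₂ - β₁ * α₂ with hD
  have hD0 : 0 < D := by
    have g1 : β₁ * α₂ ≤ (η * α₁) * α₂ := mul_le_mul_of_nonpos_right hβ₁ n2
    have g2 : (η * α₁) * α₂ ≤ (η * α₁) * (η * β₂) :=
      mul_le_mul_of_nonpos_left hα₂ (mul_neg_of_pos_of_neg h0 hα₁).le
    have g3 : η * η < 1 := by nlinarith
    have g4 : (η * η) * (α₁ * β₂) < 1 * (α₁ * β₂) := mul_lt_mul_of_pos_right g3 hpp
    linarith
  set Q := (-α₁ - β₂) / D with hQ
  have hQ0 : 0 < Q := div_pos (by linarith) hD0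
  set M := |x₁| + |x₂| + |a| + |b| + 1 with hM
  have hM0 : 0 < M := by positivity
  refine ⟨min (1 / (2 * Q)) (ε / (Q * M)), by positivity, ?_⟩
  intro α β x c1 c2 c3 c4 c5 c6
  set τ := min (1 / (2 * Q)) (ε / (Q * M)) with hτ
  have hτ0 : 0 < τ := by positivity
  have hτ1 : τ * Q ≤ 1 / 2 := by
    have : τ ≤ 1 / (2 * Q) := min_le_left _ _
    rw [le_div_iff₀ (by positivity)] at this
    linarith
  have hτ2 : τ * Q * M ≤ ε := by
    have : τ ≤ ε / (Q * M) := min_le_right _ _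
    rw [le_div_iff₀ (by positivity)] at this
    linarith
  have hα0 : α ≤ 0 := by
    have : η * β ≤ η * (η * α) := mul_le_mul_of_nonneg_left c2 h0.le
    by_contra hpos
    push Not at hpos
    have g3 : η * η < 1 := by nlinarith
    have g4 : (η * η) * α < 1 * α := mul_lt_mul_of_pos_right g3 hpos
    linarith
  have hβ0 : β ≤ 0 := c2.trans (mul_nonpos_of_nonneg_of_nonpos h0.le hα0)
  set s₁ := (α * β₂ - β * α₂) / D with hs₁
  set s₂ := (α₁ * β - β₁ * α) / D with hs₂
  have s₁0 : 0 ≤ s₁ := by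
    apply div_nonneg _ hD0.le
    have g1 : β * α₂ ≤ β * (η * β₂) := mul_le_mul_of_nonpos_left hα₂ hβ0
    have g2 : (η * β) * β₂ ≤ α * β₂ := mul_le_mul_of_nonpos_right c1 hβ₂.le
    linarith
  have s₂0 : 0 ≤ s₂ := by
    apply div_nonneg _ hD0.le
    have g1 : β₁ * α ≤ (η * α₁) * α := mul_le_mul_of_nonpos_right hβ₁ hα0
    have g2 : α₁ * (η * α) ≤ α₁ * β := mul_le_mul_of_nonpos_left c2 hα₁.le
    linarith
  have hσ : s₁ + s₂ ≤ τ * Q := by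
    rw [hs₁, hs₂, hQ, ← add_div, ← mul_div_assoc]
    apply div_le_div_of_nonneg_right _ hD0.le
    have g1 : 0 ≤ β * α₂ := mul_nonneg_of_nonpos_of_nonpos hβ0 n2
    have g2 : 0 ≤ β₁ * α := mul_nonneg_of_nonpos_of_nonpos n1 hα0
    have g3 : α * β₂ ≤ -τ * β₂ := mul_le_mul_of_nonpos_right c3 hβ₂.le
    have g4 : α₁ * β ≤ α₁ * -τ := mul_le_mul_of_nonpos_left c4 hα₁.le
    linarith
  have hα : α = s₁ * α₁ + s₂ * α₂ := by
    rw [hs₁, hs₂]; field_simp; rw [hD]; ring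
  have hβ : β = s₁ * β₁ + s₂ * β₂ := by
    rw [hs₁, hs₂]; field_simp; rw [hD]; ring
  have hr : 0 < 1 - s₁ - s₂ := by linarith
  set x' := (x - s₁ * x₁ - s₂ * x₂) / (1 - s₁ - s₂) with hx'
  have hxx : x = s₁ * x₁ + s₂ * x₂ + (1 - s₁ - s₂) * x' := by
    rw [hx']; field_simp; ring
  have hσM : (s₁ + s₂) * M ≤ ε := (mul_le_mul_of_nonneg_right hσ hM0.le).trans hτ2
  have ax1 := abs_le.1 (le_refl |x₁|)
  have ax2 := abs_le.1 (le_refl |x₂|)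
  have aa := abs_le.1 (le_refl |a|)
  have ab := abs_le.1 (le_refl |b|)
  have pa := abs_nonneg a
  have pb := abs_nonneg b
  have p1 := abs_nonneg x₁
  have p2 := abs_nonneg x₂
  have k1 : s₁ * (x₁ - a) ≤ s₁ * M := mul_le_mul_of_nonneg_left (by linarith) s₁0
  have k2 : s₂ * (x₂ - a) ≤ s₂ * M := mul_le_mul_of_nonneg_left (by linarith) s₂0
  have k3 : s₁ * (b - x₁) ≤ s₁ * M := mul_le_mul_of_nonneg_left (by linarith) s₁0
  have k4 : s₂ * (b - x₂) ≤ s₂ * M := mul_le_mul_of_nonneg_left (by linarith) s₂0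
  have hq := hin x' (by rw [hx', le_div_iff₀ hr]; linarith) (by rw [hx', div_le_iff₀ hr]; linarith)
  have hmem : s₁ • p₁ + s₂ • p₂ + (1 - s₁ - s₂) • pt r₀ f₁ f₂ e₃ 0 0 x' ∈ C := by
    have := hC.sum_mem (t := Finset.univ) (w := ![s₁, s₂, 1 - s₁ - s₂])
      (z := ![p₁, p₂, pt r₀ f₁ f₂ e₃ 0 0 x']) (by
        intro i _; fin_cases i
        · exact s₁0
        · exact s₂0
        · exact hr.le) (by simp [Fin.sum_univ_three]) (by
        intro i _; fin_cases i
        · exact hp₁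
        · exact hp₂
        · exact hq)
    simpa [Fin.sum_univ_three] using this
  have : pt r₀ f₁ f₂ e₃ α β x = s₁ • p₁ + s₂ • p₂ + (1 - s₁ - s₂) • pt r₀ f₁ f₂ e₃ 0 0 x' := by
    rw [q1, q2]
    clear_value s₁ s₂ x' α₁ β₁ x₁ α₂ β₂ x₂
    rw [hα, hβ, hxx]
    simp only [pt]
    module
  rw [this]; exact hmem

lemma out_aux {C : Set E3} {r₀ e₁ e₂ e₃ : E3} {a b : ℝ} (hC : IsCompact C)
    (neg1 : ∀ r ∈ C, ⟪r - r₀, e₁⟫ ≤ 0) (neg2 : ∀ r ∈ C, ⟪r - r₀, e₂⟫ ≤ 0)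
    (hout : ∀ r ∈ C, ⟪r - r₀, e₁⟫ = 0 → ⟪r - r₀, e₂⟫ = 0 → ⟪r - r₀, e₃⟫ ∈ Icc a b) :
    ∀ ε > 0, ∃ τ > 0, ∀ r ∈ C, -τ ≤ ⟪r - r₀, e₁⟫ → -τ ≤ ⟪r - r₀, e₂⟫ →
    ⟪r - r₀, e₃⟫ ∈ Icc (a - ε) (b + ε) := by
  intro ε hε
  have hcl : IsClosed ({r : E3 | ⟪r - r₀, e₃⟫ ≤ a - ε} ∪ {r : E3 | b + ε ≤ ⟪r - r₀, e₃⟫}) :=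
    (isClosed_le (by fun_prop) (by fun_prop)).union (isClosed_le (by fun_prop) (by fun_prop))
  have hcp := hC.inter_right hcl
  have hnot : ∀ r ∈ C, ⟪r - r₀, e₃⟫ ∉ Icc (a - ε) (b + ε) →
      r ∈ C ∩ ({r : E3 | ⟪r - r₀, e₃⟫ ≤ a - ε} ∪ {r : E3 | b + ε ≤ ⟪r - r₀, e₃⟫}) := by
    intro r hr hn
    refine ⟨hr, ?_⟩
    by_contra hcon
    apply hn
    simp only [mem_union, mem_ofPred_eq, not_or, not_le] at hcon
    exact ⟨hcon.1.le, hcon.2.le⟩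
  rcases (C ∩ ({r : E3 | ⟪r - r₀, e₃⟫ ≤ a - ε} ∪
    {r : E3 | b + ε ≤ ⟪r - r₀, e₃⟫})).eq_empty_or_nonempty with he | hne
  · refine ⟨1, one_pos, fun r hr _ _ => ?_⟩
    by_contra hn
    have := hnot r hr hn
    rw [he] at this
    exact this
  · obtain ⟨r', hr', hmax⟩ := hcp.exists_isMaxOn hne
      (f := fun r : E3 => min ⟪r - r₀, e₁⟫ ⟪r - r₀, e₂⟫) (by fun_prop)
    have hlt : min ⟪r' - r₀, e₁⟫ ⟪r' - r₀, e₂⟫ < 0 := by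
      by_contra hge
      rw [not_lt, le_min_iff] at hge
      have hx := hout r' hr'.1 (le_antisymm (neg1 _ hr'.1) hge.1)
        (le_antisymm (neg2 _ hr'.1) hge.2)
      rcases hr'.2 with h | h
      · have h' : ⟪r' - r₀, e₃⟫ ≤ a - ε := h
        linarith [hx.1]
      · have h' : b + ε ≤ ⟪r' - r₀, e₃⟫ := h
        linarith [hx.2]
    refine ⟨-(min ⟪r' - r₀, e₁⟫ ⟪r' - r₀, e₂⟫) / 2, by linarith, fun r hr g1 g2 => ?_⟩
    by_contra hn
    have h3 : min ⟪r - r₀, e₁⟫ ⟪r - r₀, e₂⟫ ≤ min ⟪r' - r₀, e₁⟫ ⟪r' - r₀, e₂⟫ :=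
      hmax (hnot r hr hn)
    have h4 := le_min g1 g2
    linarith

lemma setup_of_segment (C : Set E3) (r₀ e₁ e₂ : E3) (lam₁ lam₂ : ℝ)
    (hC : IsConvexBody C) {e₃ f₁ f₂ : E3} {c s : ℝ} (F : Frame e₁ e₂ e₃ f₁ f₂ c s)
    (hcone : tanCone C r₀ = dihedral e₁ e₂)
    (hl₁ : 0 < lam₁) (hl₂ : 0 < lam₂) (p q : E3)
    (hB₀ : Bset C r₀ (lam₁ • e₁ + lam₂ • e₂) 0 = segment ℝ p q)
    (hlt : ⟪p - r₀, e₃⟫ < ⟪q - r₀, e₃⟫) :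
    Setup C r₀ e₁ e₂ e₃ f₁ f₂ c s ⟪p - r₀, e₃⟫ ⟪q - r₀, e₃⟫ := by
  have hdi : ∀ r ∈ C, r - r₀ ∈ dihedral e₁ e₂ := fun r hr => by
    rw [← hcone]
    exact subset_closure ⟨1, r, hr, zero_le_one, by rw [one_smul]⟩
  have neg1 : ∀ r ∈ C, ⟪r - r₀, e₁⟫ ≤ 0 := fun r hr => (hdi r hr).1
  have neg2 : ∀ r ∈ C, ⟪r - r₀, e₂⟫ ≤ 0 := fun r hr => (hdi r hr).2
  have hB : ∀ r, r ∈ segment ℝ p q ↔ r ∈ C ∧ ⟪r - r₀, e₁⟫ = 0 ∧ ⟪r - r₀, e₂⟫ = 0 := by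
    intro r
    rw [← hB₀]
    simp only [Bset, mem_inter_iff, mem_ofPred_eq, inner_add_right, inner_smul_right, neg_zero]
    constructor
    · rintro ⟨hr, h⟩
      have h3 : lam₁ * ⟪r - r₀, e₁⟫ ≤ 0 := mul_nonpos_of_nonneg_of_nonpos hl₁.le (neg1 r hr)
      have h3' : lam₂ * ⟪r - r₀, e₂⟫ ≤ 0 := mul_nonpos_of_nonneg_of_nonpos hl₂.le (neg2 r hr)
      refine ⟨hr, ?_, ?_⟩
      · have : lam₁ * ⟪r - r₀, e₁⟫ = 0 := by linarith
        exact (mul_eq_zero.1 this).resolve_left hl₁.ne'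
      · have : lam₂ * ⟪r - r₀, e₂⟫ = 0 := by linarith
        exact (mul_eq_zero.1 this).resolve_left hl₂.ne'
    · rintro ⟨hr, h, h'⟩
      exact ⟨hr, by rw [h, h']; simp⟩
  have hp := (hB p).1 (left_mem_segment ℝ p q)
  have hq := (hB q).1 (right_mem_segment ℝ p q)
  have ep := pt_eq (r₀ := r₀) F p
  have eq := pt_eq (r₀ := r₀) F q
  rw [hp.2.1, hp.2.2] at ep
  rw [hq.2.1, hq.2.2] at eq
  refine ⟨F, hC, hlt, neg1, neg2, inn_aux F hC.2.1 hcone neg1 neg2 ?_,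
    out_aux hC.1 neg1 neg2 ?_⟩
  · intro x hx1 hx2
    refine ((hB _).1 ?_).1
    set xp := ⟪p - r₀, e₃⟫
    set xq := ⟪q - r₀, e₃⟫
    have hd : 0 < xq - xp := by linarith
    refine ⟨(xq - x) / (xq - xp), (x - xp) / (xq - xp), div_nonneg (by linarith) hd.le,
      div_nonneg (by linarith) hd.le, by field_simp; ring, ?_⟩
    rw [ep, eq]
    clear_value xp xq
    have hx : x = (xq - x) / (xq - xp) * xp + (x - xp) / (xq - xp) * xq := by
      field_simp; ring
    have h1 : (x - xp) / (xq - xp) = 1 - (xq - x) / (xq - xp) := by field_simp; ring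
    rw [h1] at hx ⊢
    set u := (xq - x) / (xq - xp)
    clear_value u
    rw [hx]
    simp only [pt]
    module
  · intro r hr h1 h2
    obtain ⟨u, v, hu, hv, huv, rfl⟩ := (hB r).2 ⟨hr, h1, h2⟩
    have e : u • p + v • q - r₀ = u • (p - r₀) + v • (q - r₀) := by
      have : u = 1 - v := by linarith
      rw [this]; module
    rw [e, inner_add_left, real_inner_smul_left, real_inner_smul_left]
    have hu' : u = 1 - v := by linarith
    have g1 : 0 ≤ v * (⟪q - r₀, e₃⟫ - ⟪p - r₀, e₃⟫) := mul_nonneg hv (by linarith)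
    have g2 : 0 ≤ u * (⟪q - r₀, e₃⟫ - ⟪p - r₀, e₃⟫) := mul_nonneg hu (by linarith)
    constructor
    · rw [hu']; linarith
    · have hv' : v = 1 - u := by linarith
      rw [hv']; linarith

lemma seg_x_ne {C : Set E3} {r₀ e₁ e₂ e₃ f₁ f₂ : E3} {c s lam₁ lam₂ : ℝ}
    (F : Frame e₁ e₂ e₃ f₁ f₂ c s) (hcone : tanCone C r₀ = dihedral e₁ e₂)
    (hl₁ : 0 < lam₁) (hl₂ : 0 < lam₂) (p q : E3) (hpq : p ≠ q)
    (hp : p ∈ Bset C r₀ (lam₁ • e₁ + lam₂ • e₂) 0)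
    (hq : q ∈ Bset C r₀ (lam₁ • e₁ + lam₂ • e₂) 0) : ⟪p - r₀, e₃⟫ ≠ ⟪q - r₀, e₃⟫ := by
  have hdi : ∀ r ∈ C, r - r₀ ∈ dihedral e₁ e₂ := fun r hr => by
    rw [← hcone]
    exact subset_closure ⟨1, r, hr, zero_le_one, by rw [one_smul]⟩
  have hz : ∀ r ∈ Bset C r₀ (lam₁ • e₁ + lam₂ • e₂) 0,
      ⟪r - r₀, e₁⟫ = 0 ∧ ⟪r - r₀, e₂⟫ = 0 := by
    rintro r ⟨hr, h⟩
    simp only [mem_ofPred_eq, inner_add_right, inner_smul_right, neg_zero] at h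
    have h3 : lam₁ * ⟪r - r₀, e₁⟫ ≤ 0 := mul_nonpos_of_nonneg_of_nonpos hl₁.le (hdi r hr).1
    have h3' : lam₂ * ⟪r - r₀, e₂⟫ ≤ 0 := mul_nonpos_of_nonneg_of_nonpos hl₂.le (hdi r hr).2
    refine ⟨?_, ?_⟩
    · have : lam₁ * ⟪r - r₀, e₁⟫ = 0 := by linarith
      exact (mul_eq_zero.1 this).resolve_left hl₁.ne'
    · have : lam₂ * ⟪r - r₀, e₂⟫ = 0 := by linarith
      exact (mul_eq_zero.1 this).resolve_left hl₂.ne'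
  intro h
  apply hpq
  rw [pt_eq (r₀ := r₀) F p, pt_eq (r₀ := r₀) F q, (hz p hp).1, (hz p hp).2, (hz q hq).1,
    (hz q hq).2, h]

/-- **Theorem 1 (paper Thm 1.1).** If `B₀ = C ∩ {r : ⟪r - r₀, e⟫ = 0}` is a
non-degenerate line segment, then `ν_t` weakly converges, as `t → 0⁺`, to
`λ₁ δ_{e₁} + λ₂ δ_{e₂}`. -/
theorem nuT_tendsto_two_atoms_of_segment
    (C : Set E3) (r₀ e₁ e₂ e : E3) (lam₁ lam₂ : ℝ)
    (hC : IsConvexBody C) (hr₀ : r₀ ∈ frontier C)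
    (he₁ : ‖e₁‖ = 1) (he₂ : ‖e₂‖ = 1) (hne : e₁ ≠ e₂) (hne' : e₁ ≠ -e₂)
    (hcone : tanCone C r₀ = dihedral e₁ e₂)
    (hl₁ : 0 < lam₁) (hl₂ : 0 < lam₂) (he : e = lam₁ • e₁ + lam₂ • e₂) (hnorm : ‖e‖ = 1)
    (hB₀ : ∃ p q : E3, p ≠ q ∧ Bset C r₀ e 0 = segment ℝ p q) :
    WeaklyTendsto (nuT C r₀ e)
      (ENNReal.ofReal lam₁ • Measure.dirac e₁ + ENNReal.ofReal lam₂ • Measure.dirac e₂) := by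
  obtain ⟨p, q, hpq, hB⟩ := hB₀
  obtain ⟨e₃, f₁, f₂, s, F⟩ := frame_exists e₁ e₂ he₁ he₂ hne hne'
  subst he
  have hl : lam₁ ^ 2 + lam₂ ^ 2 + 2 * ⟪e₁, e₂⟫ * lam₁ * lam₂ = 1 := by
    have h1 : ⟪lam₁ • e₁ + lam₂ • e₂, lam₁ • e₁ + lam₂ • e₂⟫ = 1 := by
      rw [real_inner_self_eq_norm_sq, hnorm]; norm_num
    simp only [inner_add_left, inner_add_right, real_inner_smul_left, inner_smul_right, F.h11,
      F.h22, F.swap.h12] at h1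
    linarith
  have hx := seg_x_ne F hcone hl₁ hl₂ p q hpq (hB ▸ left_mem_segment ℝ p q)
    (hB ▸ right_mem_segment ℝ p q)
  rcases lt_or_gt_of_ne hx with h | h
  · exact (setup_of_segment C r₀ e₁ e₂ lam₁ lam₂ hC F hcone hl₁ hl₂ p q hB h).main hl₁ hl₂ hl hne
  · exact (setup_of_segment C r₀ e₁ e₂ lam₁ lam₂ hC F hcone hl₁ hl₂ q p
      (by rw [hB, segment_symm]) h).main hl₁ hl₂ hl hne
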